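/- arXiv:2409.20275 — 2 statements merged into one kernel-verified Lean document; each statement's English description precedes it below -/
import Mathlib

section
/- Let A be a real n×n matrix and c a real 1×n row vector such that the pair (A,c) is observable. For r ∈ {1,…,n} and integer t ≥ 1, let M_r[t] be the n×n real matrix whose first n−r rows are c, cA, …, cA^{n−r−1} and whose last r rows are cA^{n−r+t−1}, cA^{n−r+t}, …, cA^{n+t−2}. Then the observability operator O of (A,c) is strictly (n−1)-variation bounding if and only if det(O_n)·det(M_r[t]) > 0 for every r ∈ {1,…,n} and every integer t ≥ 1. -/
open Matrix Polynomial Filter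

noncomputable def signChanges (l : List ℝ) : ℕ :=
  (l.zip l.tail).countP (fun p => decide (p.1 * p.2 < 0))

/-- Variation `V(u)`: number of sign changes after deleting zero entries, `-1` for the
zero vector. -/
noncomputable def variation {m : ℕ} (u : Fin m → ℝ) : ℤ :=
  if ((List.ofFn u).filter fun x => decide (x ≠ 0)) = [] then -1
  else (signChanges ((List.ofFn u).filter fun x => decide (x ≠ 0)) : ℤ)

/-- Maximal variation `V_z(u)`: largest number of sign changes obtainable by replacing every
zero entry of `u` by an arbitrary nonzero real number. -/
noncomputable def maxVariation {m : ℕ} (u : Fin m → ℝ) : ℤ :=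
  sSup {v : ℤ | ∃ w : Fin m → ℝ, (∀ i, w i ≠ 0) ∧ (∀ i, u i ≠ 0 → w i = u i) ∧
    v = (signChanges (List.ofFn w) : ℤ)}

/-- `X` is strictly `k`-variation bounding. -/
def SVB {n m : ℕ} (X : Matrix (Fin n) (Fin m) ℝ) (k : ℕ) : Prop :=
  ∀ u : Fin m → ℝ, u ≠ 0 → variation u ≤ (k : ℤ) → maxVariation (X.mulVec u) ≤ (k : ℤ)

/-- `X` is `k`-variation bounding. -/
def VB {n m : ℕ} (X : Matrix (Fin n) (Fin m) ℝ) (k : ℕ) : Prop :=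
  ∀ u : Fin m → ℝ, u ≠ 0 → variation u ≤ (k : ℤ) → variation (X.mulVec u) ≤ (k : ℤ)

/-- `X` is `k`-variation diminishing. -/
def VD {n m : ℕ} (X : Matrix (Fin n) (Fin m) ℝ) (k : ℕ) : Prop :=
  ∀ j : ℕ, j ≤ k → VB X j

/-- `X` is strictly `k`-sign consistent: all `k×k` minors strictly positive, or all strictly
negative. -/
def SSC {n m : ℕ} (X : Matrix (Fin n) (Fin m) ℝ) (k : ℕ) : Prop :=
  (∀ (f : Fin k → Fin n) (g : Fin k → Fin m), StrictMono f → StrictMono g →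
    0 < (X.submatrix f g).det) ∨
  (∀ (f : Fin k → Fin n) (g : Fin k → Fin m), StrictMono f → StrictMono g →
    (X.submatrix f g).det < 0)

/-- `X` is `k`-sign consistent: all `k×k` minors nonnegative, or all nonpositive. -/
def SC {n m : ℕ} (X : Matrix (Fin n) (Fin m) ℝ) (k : ℕ) : Prop :=
  (∀ (f : Fin k → Fin n) (g : Fin k → Fin m), StrictMono f → StrictMono g →
    0 ≤ (X.submatrix f g).det) ∨
  (∀ (f : Fin k → Fin n) (g : Fin k → Fin m), StrictMono f → StrictMono g →
    (X.submatrix f g).det ≤ 0)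

/-- `X` is `k`-sign regular. -/
def SR {n m : ℕ} (X : Matrix (Fin n) (Fin m) ℝ) (k : ℕ) : Prop :=
  ∀ j : ℕ, 1 ≤ j → j ≤ k → SC X j

/-- `X` is strictly totally positive. -/
def STP {n m : ℕ} (X : Matrix (Fin n) (Fin m) ℝ) : Prop :=
  ∀ (j : ℕ) (f : Fin j → Fin n) (g : Fin j → Fin m), StrictMono f → StrictMono g →
    0 < (X.submatrix f g).det

/-- `X` is `k`-positive: all `j×j` minors nonnegative for `j = 1, …, k`. -/
def KPos {n m : ℕ} (X : Matrix (Fin n) (Fin m) ℝ) (k : ℕ) : Prop :=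
  ∀ j : ℕ, 1 ≤ j → j ≤ k → ∀ (f : Fin j → Fin n) (g : Fin j → Fin m),
    StrictMono f → StrictMono g → 0 ≤ (X.submatrix f g).det

/-- `X` is strictly `k`-positive: all `j×j` minors positive for `j = 1, …, k`. -/
def KPosStrict {n m : ℕ} (X : Matrix (Fin n) (Fin m) ℝ) (k : ℕ) : Prop :=
  ∀ j : ℕ, 1 ≤ j → j ≤ k → ∀ (f : Fin j → Fin n) (g : Fin j → Fin m),
    StrictMono f → StrictMono g → 0 < (X.submatrix f g).det

/-- The `t`-step observability matrix `O_t` with `i`-th row `c Aⁱ⁻¹`. -/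
noncomputable def obsMat {n : ℕ} (A : Matrix (Fin n) (Fin n) ℝ) (c : Fin n → ℝ) (t : ℕ) :
    Matrix (Fin t) (Fin n) ℝ :=
  Matrix.of fun i j => Matrix.vecMul c (A ^ (i : ℕ)) j

/-- The pair `(A, c)` is observable. -/
def Observable {n : ℕ} (A : Matrix (Fin n) (Fin n) ℝ) (c : Fin n → ℝ) : Prop :=
  (obsMat A c n).det ≠ 0

/-- The observability operator of `(A, c)` is strictly `k`-variation bounding. -/
def ObsSVB {n : ℕ} (A : Matrix (Fin n) (Fin n) ℝ) (c : Fin n → ℝ) (k : ℕ) : Prop :=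
  ∀ t : ℕ, 0 < t → SVB (obsMat A c t) k

/-- The observability operator of `(A, c)` is `k`-variation bounding. -/
def ObsVB {n : ℕ} (A : Matrix (Fin n) (Fin n) ℝ) (c : Fin n → ℝ) (k : ℕ) : Prop :=
  ∀ t : ℕ, 0 < t → VB (obsMat A c t) k

/-- The matrix `M_r[t]`: first `n - r` rows `c, cA, …, cA^{n-r-1}`, last `r` rows
`cA^{n-r+t-1}, …, cA^{n+t-2}`. -/
noncomputable def Mrt {n : ℕ} (A : Matrix (Fin n) (Fin n) ℝ) (c : Fin n → ℝ) (r t : ℕ) :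
    Matrix (Fin n) (Fin n) ℝ :=
  Matrix.of fun i j =>
    Matrix.vecMul c (A ^ (if (i : ℕ) < n - r then (i : ℕ) else (i : ℕ) + t - 1)) j


theorem signChanges_cons_cons (a b : ℝ) (l : List ℝ) :
    signChanges (a :: b :: l) = signChanges (b :: l) + if a * b < 0 then 1 else 0 := by
  simp [signChanges, List.countP_cons]

theorem signChanges_add_one_le_length {l : List ℝ} (hl : l ≠ []) :
    signChanges l + 1 ≤ l.length := by
  have h : signChanges l ≤ (l.zip l.tail).length := List.countP_le_length
  have := List.length_pos_iff.2 hl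
  rw [List.length_zip, List.length_tail] at h
  omega

theorem signChanges_le_length (l : List ℝ) : signChanges l ≤ l.length := by
  refine List.countP_le_length.trans ?_
  simp

/-- A list of nonzero reals has a strictly alternating sublist, starting at the same entry, which
realizes its number of sign changes. -/
theorem exists_alternating_sublist (t : List ℝ) :
    ∀ a : ℝ, (∀ x ∈ a :: t, x ≠ 0) →
      ∃ l, l.Sublist t ∧ (a :: l).IsChain (fun x y => x * y < 0) ∧
        l.length = signChanges (a :: t) := by
  induction t with
  | nil => intro a _; exact ⟨[], by simp [signChanges]⟩
  | cons b t ih =>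
    intro a h
    obtain ⟨l, hl, hc, hlen⟩ := ih b fun x hx => h x (List.mem_cons_of_mem _ hx)
    have ha : a ≠ 0 := h a (by simp)
    have hb : b ≠ 0 := h b (by simp)
    rw [signChanges_cons_cons]
    by_cases hab : a * b < 0
    · exact ⟨b :: l, hl.cons_cons b, List.isChain_cons_cons.2 ⟨hab, hc⟩, by simp [hab, hlen]⟩
    · refine ⟨l, hl.cons b, ?_, by simp [hab, hlen]⟩
      cases l with
      | nil => simp
      | cons d l =>
        rw [List.isChain_cons_cons] at hc ⊢
        refine ⟨?_, hc.2⟩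
        have hab' : 0 < a * b := lt_of_le_of_ne (not_lt.1 hab) (mul_ne_zero ha hb).symm
        have hbd := hc.1
        have hb2 : 0 < b * b := mul_self_pos.2 hb
        by_contra hcon
        nlinarith [mul_neg_of_pos_of_neg hab' hbd, mul_nonneg (not_lt.1 hcon) hb2.le]

theorem length_le_signChanges (t : List ℝ) :
    ∀ (a : ℝ) (l : List ℝ), (∀ x ∈ a :: t, x ≠ 0) → l.Sublist t →
      (a :: l).IsChain (fun x y => x * y < 0) → l.length ≤ signChanges (a :: t) := by
  induction t with
  | nil => intro a l _ hl _; simp [List.sublist_nil.1 hl]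
  | cons b t ih =>
    intro a l h hl hc
    have hbt : ∀ x ∈ b :: t, x ≠ 0 := fun x hx => h x (List.mem_cons_of_mem _ hx)
    have hb : b ≠ 0 := hbt b (by simp)
    have ha : a ≠ 0 := h a (by simp)
    rw [signChanges_cons_cons]
    cases hl with
    | cons_cons _ hl =>
      rw [List.isChain_cons_cons] at hc
      have := ih b _ hbt hl hc.2
      simp [hc.1, this]
    | cons _ hl =>
      cases l with
      | nil => simp
      | cons d l =>
        rw [List.isChain_cons_cons] at hc
        have hd : d ≠ 0 := right_ne_zero_of_mul hc.1.ne
        by_cases hab : a * b < 0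
        · have hbd : 0 < b * d := by
            have h1 := mul_pos_of_neg_of_neg hab hc.1
            have h2 : 0 < a * a := mul_self_pos.2 ha
            by_contra hcon
            nlinarith [mul_nonneg h2.le (neg_nonneg.2 (not_lt.1 hcon))]
          have hbl : (b :: l).IsChain (fun x y => x * y < 0) := by
            cases l with
            | nil => simp
            | cons e l =>
              have hc2 := hc.2
              rw [List.isChain_cons_cons] at hc2 ⊢
              refine ⟨?_, hc2.2⟩
              have h2 : 0 < d * d := mul_self_pos.2 hd
              by_contra hcon
              nlinarith [mul_neg_of_pos_of_neg hbd hc2.1, mul_nonneg (not_lt.1 hcon) h2.le]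
          have := ih b l hbt ((List.sublist_cons_self d l).trans hl) hbl
          simp [hab, this]
        · have hbd : b * d < 0 := by
            have h1 : 0 < a * b := lt_of_le_of_ne (not_lt.1 hab) (mul_ne_zero ha hb).symm
            have h2 : 0 < a * a := mul_self_pos.2 ha
            by_contra hcon
            nlinarith [mul_neg_of_pos_of_neg h1 hc.1, mul_nonneg (not_lt.1 hcon) h2.le]
          have := ih b (d :: l) hbt hl (List.isChain_cons_cons.2 ⟨hbd, hc.2⟩)
          simpa [hab] using this

theorem exists_alternating_of_le_signChanges {m k : ℕ} (w : Fin m → ℝ) (hw : ∀ i, w i ≠ 0)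
    (hm : 0 < m) (hk : k ≤ signChanges (List.ofFn w)) :
    ∃ f : Fin (k + 1) → Fin m, StrictMono f ∧
      ∀ i : Fin (k + 1), 0 < (-1) ^ (i : ℕ) * (w (f 0) * w (f i)) := by
  obtain ⟨m, rfl⟩ := Nat.exists_eq_add_one_of_ne_zero hm.ne'
  have hcons : List.ofFn w = w 0 :: List.ofFn (fun i : Fin m => w i.succ) := by
    rw [List.ofFn_succ]
  obtain ⟨l, hl, hc, hlen⟩ := exists_alternating_sublist
    (List.ofFn fun i : Fin m => w i.succ) (w 0) (by
      rw [← hcons]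
      intro x hx
      obtain ⟨i, rfl⟩ := (List.mem_ofFn' _ _).1 hx
      exact hw i)
  rw [← hcons] at hlen
  have hsub : (w 0 :: l).Sublist (List.ofFn w) := hcons ▸ hl.cons_cons _
  obtain ⟨f, hf⟩ := List.sublist_iff_exists_fin_orderEmbedding_get_eq.1 hsub
  have hlen' : k + 1 ≤ (w 0 :: l).length := by simp; omega
  let g : Fin (k + 1) → Fin (m + 1) := fun i => Fin.cast (by simp) (f (Fin.castLE hlen' i))
  have hg : ∀ i : Fin (k + 1), w (g i) = (w 0 :: l)[(i : ℕ)]'(by omega) := by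
    intro i
    have := hf (Fin.castLE hlen' i)
    simp only [List.get_eq_getElem, List.getElem_ofFn, Fin.val_castLE] at this
    rw [this]
    rfl
  refine ⟨g, ?_, ?_⟩
  · intro i j hij
    have : f (Fin.castLE hlen' i) < f (Fin.castLE hlen' j) := f.strictMono hij
    exact this
  · have key : ∀ i (hi : i < k + 1), 0 < (-1) ^ i * (w (g 0) * w (g ⟨i, hi⟩)) := by
      intro i
      induction i with
      | zero =>
        intro hi
        have := mul_self_pos.2 (hw (g 0))
        simpa using this
      | succ i ih =>
        intro hi
        have h1 := ih (by omega)
        have h2 : w (g ⟨i, by omega⟩) * w (g ⟨i + 1, hi⟩) < 0 := by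
          rw [hg, hg]
          exact List.isChain_iff_getElem.1 hc i (by simp at hlen' ⊢; omega)
        have h3 : 0 < w (g ⟨i, by omega⟩) * w (g ⟨i, by omega⟩) := mul_self_pos.2 (hw _)
        rw [pow_succ]
        by_contra hcon
        nlinarith [mul_neg_of_pos_of_neg h1 h2, mul_nonneg (neg_nonneg.2 (not_lt.1 hcon)) h3.le]
    exact fun i => key i i.2

theorem le_signChanges_of_alternating {m k : ℕ} (w : Fin m → ℝ) (hw : ∀ i, w i ≠ 0)
    (f : Fin (k + 1) → Fin m) (hf : StrictMono f)
    (h : ∀ i : Fin (k + 1), 0 < (-1) ^ (i : ℕ) * w (f i)) : k ≤ signChanges (List.ofFn w) := by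
  have hsub : (List.ofFn fun i => w (f i)).Sublist (List.ofFn w) := by
    rw [List.sublist_iff_exists_fin_orderEmbedding_get_eq]
    refine ⟨OrderEmbedding.ofStrictMono
      (fun i => Fin.cast (by simp) (f (Fin.cast (by simp) i))) ?_, ?_⟩
    · intro i j hij
      exact hf (show Fin.cast _ i < Fin.cast _ j from hij)
    · intro i
      simp only [List.get_eq_getElem, List.getElem_ofFn]
      rfl
  have hchain : (List.ofFn fun i => w (f i)).IsChain (fun x y => x * y < 0) := by
    rw [List.isChain_iff_getElem]
    intro i hi
    simp only [List.length_ofFn] at hi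
    simp only [List.getElem_ofFn]
    have h1 := h ⟨i, by omega⟩
    have h2 := h ⟨i + 1, hi⟩
    have h3 := mul_pos h1 h2
    have h4 : ((-1 : ℝ) ^ i) * (-1) ^ i = 1 := by rw [← mul_pow]; simp
    have h5 : (-1 : ℝ) ^ i * w (f ⟨i, by omega⟩) * ((-1) ^ (i + 1) * w (f ⟨i + 1, hi⟩))
        = -(w (f ⟨i, by omega⟩) * w (f ⟨i + 1, hi⟩)) := by
      linear_combination (-(w (f ⟨i, by omega⟩) * w (f ⟨i + 1, hi⟩))) * h4
    simp only at h3
    linarith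
  have hw' : ∀ x ∈ List.ofFn w, x ≠ 0 := by
    intro x hx
    obtain ⟨i, rfl⟩ := (List.mem_ofFn' _ _).1 hx
    exact hw i
  have hlen : (List.ofFn fun i => w (f i)).length = k + 1 := by simp
  generalize (List.ofFn fun i => w (f i)) = l' at *
  generalize List.ofFn w = l at *
  cases l with
  | nil => simp [List.sublist_nil.1 hsub] at hlen
  | cons a t =>
    cases hsub with
    | cons_cons _ hs =>
      have := length_le_signChanges t a _ hw' hs hchain
      simp at hlen
      omega
    | cons _ hs =>
      cases l' with
      | nil => simp at hlen
      | cons b l' =>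
        by_cases hab : a * b < 0
        · have := length_le_signChanges t a _ hw' hs (List.isChain_cons_cons.2 ⟨hab, hchain⟩)
          simp at this hlen
          omega
        · have ha : a ≠ 0 := hw' a (by simp)
          have hb : b ≠ 0 := hw' b (by simp [hs.subset (List.mem_cons_self)])
          have hab' : 0 < a * b := lt_of_le_of_ne (not_lt.1 hab) (mul_ne_zero ha hb).symm
          have hc : (a :: l').IsChain (fun x y => x * y < 0) := by
            cases l' with
            | nil => simp
            | cons e l =>
              rw [List.isChain_cons_cons] at hchain ⊢
              refine ⟨?_, hchain.2⟩
              have h2 : 0 < b * b := mul_self_pos.2 hb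
              by_contra hcon
              nlinarith [mul_neg_of_pos_of_neg hab' hchain.1,
                mul_nonneg (not_lt.1 hcon) h2.le]
          have := length_le_signChanges t a _ hw' ((List.sublist_cons_self b l').trans hs) hc
          simp at hlen
          omega

theorem maxVariation_le_iff {m : ℕ} (y : Fin m → ℝ) (k : ℤ) :
    maxVariation y ≤ k ↔ ∀ w : Fin m → ℝ, (∀ i, w i ≠ 0) → (∀ i, y i ≠ 0 → w i = y i) →
      (signChanges (List.ofFn w) : ℤ) ≤ k := by
  unfold maxVariation
  rw [csSup_le_iff]
  · constructor
    · intro h w h1 h2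
      exact h _ ⟨w, h1, h2, rfl⟩
    · rintro h _ ⟨w, h1, h2, rfl⟩
      exact h w h1 h2
  · refine ⟨m, ?_⟩
    rintro _ ⟨w, -, -, rfl⟩
    exact_mod_cast (signChanges_le_length _).trans (by simp)
  · classical
    exact ⟨_, fun i => if y i = 0 then 1 else y i, fun i => by dsimp; split_ifs <;> simp_all,
      fun i hi => by simp [hi], rfl⟩

theorem le_maxVariation_of_weakly_alternating {m n : ℕ} (y : Fin m → ℝ)
    (f : Fin (n + 1) → Fin m) (hf : StrictMono f)
    (h : ∀ i : Fin (n + 1), 0 ≤ (-1) ^ (i : ℕ) * y (f i)) : (n : ℤ) ≤ maxVariation y := by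
  classical
  let w : Fin m → ℝ := fun i => if y i ≠ 0 then y i else
    if hi : ∃ k, f k = i then (-1) ^ (hi.choose : ℕ) else 1
  have hw : ∀ i, w i ≠ 0 := by
    intro i
    dsimp only [w]
    split_ifs with h1 h2
    · exact h1
    · exact pow_ne_zero _ (by norm_num)
    · exact one_ne_zero
  have hwf : ∀ i : Fin (n + 1), 0 < (-1) ^ (i : ℕ) * w (f i) := by
    intro i
    refine lt_of_le_of_ne ?_ (mul_ne_zero (pow_ne_zero _ (by norm_num)) (hw _)).symm
    dsimp only [w]
    split_ifs with h1 h2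
    · exact h i
    · rw [hf.injective h2.choose_spec, ← mul_pow]
      simp
    · exact absurd ⟨i, rfl⟩ h2
  have h1 := (maxVariation_le_iff y _).1 le_rfl w hw (fun i hi => by simp [w, hi])
  exact le_trans (by exact_mod_cast le_signChanges_of_alternating w hw f hf hwf) h1

theorem maxVariation_le_sub_one_of_forall {m n : ℕ} (y : Fin m → ℝ) (hm : 0 < m)
    (h : ∀ (σ : ℝ) (f : Fin (n + 1) → Fin m), σ ≠ 0 → StrictMono f →
      ¬ ∀ i : Fin (n + 1), 0 ≤ (-1) ^ (i : ℕ) * (σ * y (f i))) : maxVariation y ≤ (n : ℤ) - 1 := by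
  rw [maxVariation_le_iff]
  intro w hw hyw
  by_contra hcon
  obtain ⟨f, hf, hfw⟩ := exists_alternating_of_le_signChanges (k := n) w hw hm (by omega)
  refine h (w (f 0)) f (hw _) hf fun i => ?_
  by_cases hi : y (f i) = 0
  · simp [hi]
  · rw [← hyw _ hi]
    exact (hfw i).le

theorem exists_step_of_le {z : ℕ → ℝ} {a b : ℕ} (hab : a < b) {ε : ℝ}
    (h : 0 ≤ ε * (z a - z b)) : ∃ g, a ≤ g ∧ g < b ∧ 0 ≤ ε * (z g - z (g + 1)) := by
  by_contra! hcon
  have key : ∀ d, a + d < b → ε * (z a - z (a + d + 1)) < 0 := by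
    intro d
    induction d with
    | zero => intro hd; exact hcon a le_rfl hab
    | succ d ih =>
      intro hd
      have h1 := ih (by omega)
      have h2 := hcon (a + d + 1) (by omega) (by omega)
      rw [show a + (d + 1) = a + d + 1 by ring]
      linarith
  obtain ⟨d, rfl⟩ := Nat.exists_eq_add_of_lt hab
  exact absurd h (not_le.2 (key d (by omega)))

/-- Determinant of a matrix whose last column is constantly one, by differencing rows. -/
theorem det_of_last_column_eq_one {r : ℕ} (M : Matrix (Fin (r + 1)) (Fin (r + 1)) ℝ)
    (h : ∀ i, M i (Fin.last r) = 1) :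
    M.det = (Matrix.of fun i j : Fin r =>
      M i.castSucc j.castSucc - M i.succ j.castSucc).det := by
  rw [← det_submatrix_equiv_self Fin.revPerm M,
    det_eq_of_forall_row_eq_smul_add_pred
      (B := Matrix.of fun i j => Fin.cases (M (Fin.last r) j.rev)
        (fun i : Fin r => M i.rev.castSucc j.rev - M i.rev.succ j.rev) i) (fun _ => 1),
    det_succ_column_zero, Fin.sum_univ_succ, Finset.sum_eq_zero,
    ← det_submatrix_equiv_self Fin.revPerm (Matrix.of fun i j : Fin r => _)]
  · simp only [of_apply, Fin.cases_zero, Fin.rev_zero, h, Fin.val_zero, pow_zero, one_mul,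
      add_zero]
    congr 1
    ext i j
    simp [Fin.succAbove_zero, Fin.rev_succ]
  · intro i _
    simp [h]
  · intro j
    simp
  · intro i j
    simp [Fin.rev_succ, Fin.rev_castSucc]

theorem det_eq_prod_mul_det_differences (U : ℕ → ℕ → ℝ) (hU : ∀ s, U 0 s ≠ 0) (r s : ℕ) :
    (Matrix.of fun i j : Fin (r + 1) => U (j.rev : ℕ) (s + i)).det =
      (∏ i : Fin (r + 1), U 0 (s + i)) * (Matrix.of fun i j : Fin r =>
        U (j.rev + 1 : ℕ) (s + i) / U 0 (s + i) -
          U (j.rev + 1 : ℕ) (s + i + 1) / U 0 (s + i + 1)).det := by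
  have h1 : (Matrix.of fun i j : Fin (r + 1) => U (j.rev : ℕ) (s + i)) =
      Matrix.of fun i j : Fin (r + 1) => U 0 (s + i) *
        (Matrix.of fun i j : Fin (r + 1) => U (j.rev : ℕ) (s + i) / U 0 (s + i)) i j := by
    ext i j
    simp only [of_apply]
    field_simp [hU]
  rw [h1, det_mul_column, det_of_last_column_eq_one]
  · congr 2
    ext i j
    simp [show r - (j + 1 : ℕ) + 1 = r - j by omega, add_assoc]
  · intro i
    simp [hU]


/-- A discrete Chebyshev system: if all the consecutive minors of the first `r` sequences are
positive for each `r ≤ n`, then no nontrivial combination weakly alternates `n` times. -/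
theorem coeff_eq_zero_of_weakly_alternating (n : ℕ) : ∀ (U : ℕ → ℕ → ℝ),
    (∀ r ≤ n, ∀ s, 0 < (Matrix.of fun i j : Fin r => U (j.rev : ℕ) (s + i)).det) →
    ∀ (a : ℕ → ℝ) (f : ℕ → ℕ), (∀ k < n, f k < f (k + 1)) →
    (∀ k ≤ n, 0 ≤ (-1) ^ k * ∑ j ∈ Finset.range n, a j * U j (f k)) → ∀ j < n, a j = 0 := by
  induction n with
  | zero => intro U _ a f _ _ j hj; omega
  | succ n ih =>
    intro U hU a f hf hy
    have hU0 : ∀ s, 0 < U 0 s := by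
      intro s
      have := hU 1 (by omega) s
      simpa [det_unique] using this
    have hz : ∀ k ≤ n + 1,
        0 ≤ (-1) ^ k * ∑ j ∈ Finset.range (n + 1), a j * (U j (f k) / U 0 (f k)) := by
      intro k hk
      have h1 := div_nonneg (hy k hk) (hU0 (f k)).le
      rw [mul_div_assoc, Finset.sum_div] at h1
      simpa only [mul_div_assoc] using h1
    set z : ℕ → ℝ := fun s => ∑ j ∈ Finset.range (n + 1), a j * (U j s / U 0 s) with hzdef
    have hstep : ∀ k, ∃ g, k ≤ n → f k ≤ g ∧ g < f (k + 1) ∧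
        0 ≤ (-1) ^ k * (z g - z (g + 1)) := by
      intro k
      by_cases hk : k ≤ n
      · obtain ⟨g, hg⟩ := exists_step_of_le (z := z) (hf k (by omega)) (ε := (-1) ^ k) (by
          have h1 : 0 ≤ (-1) ^ k * z (f k) := hz k (by omega)
          have h2 : 0 ≤ (-1) ^ (k + 1) * z (f (k + 1)) := hz (k + 1) (by omega)
          rw [pow_succ] at h2
          linarith)
        exact ⟨g, fun _ => hg⟩
      · exact ⟨0, fun h => absurd h hk⟩
    choose g hg using hstep
    have hdiff : ∀ s, z s - z (s + 1) = ∑ j ∈ Finset.range n,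
        a (j + 1) * (U (j + 1) s / U 0 s - U (j + 1) (s + 1) / U 0 (s + 1)) := by
      intro s
      simp only [hzdef, Finset.sum_range_succ', div_self (hU0 _).ne', mul_sub,
        Finset.sum_sub_distrib]
      ring
    have hzero := ih (fun j s => U (j + 1) s / U 0 s - U (j + 1) (s + 1) / U 0 (s + 1))
      (by
        intro r hr s
        have h1 := hU (r + 1) (by omega) s
        rw [det_eq_prod_mul_det_differences U (fun s => (hU0 s).ne')] at h1
        exact pos_of_mul_pos_right h1 (Finset.prod_nonneg fun i _ => (hU0 _).le))
      (fun j => a (j + 1)) g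
      (fun k hk => lt_of_lt_of_le (hg k (by omega)).2.1 (hg (k + 1) (by omega)).1)
      (fun k hk => by rw [← hdiff]; exact (hg k hk).2.2)
    have hy' : ∀ s, ∑ j ∈ Finset.range (n + 1), a j * U j s = a 0 * U 0 s := by
      intro s
      rw [Finset.sum_range_succ', Finset.sum_eq_zero, zero_add]
      intro j hj
      rw [hzero j (Finset.mem_range.1 hj), zero_mul]
    have h0 := hy 0 (by omega)
    have h1 := hy 1 (by omega)
    rw [hy'] at h0 h1
    have ha : a 0 = 0 := by
      have p0 := hU0 (f 0)
      have p1 := hU0 (f 1)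
      apply le_antisymm
      · by_contra hcon
        nlinarith [mul_pos (not_le.1 hcon) p1]
      · by_contra hcon
        nlinarith [mul_neg_of_neg_of_pos (not_le.1 hcon) p0]
    intro j hj
    cases j with
    | zero => exact ha
    | succ j => exact hzero j (by omega)

/-- Two maximal minors of `n + 1` rows have the same sign when no nontrivial combination of the
columns weakly alternates along these rows. -/
theorem det_mul_det_pos_of_not_weakly_alternating {n : ℕ} (X : Matrix (Fin (n + 1)) (Fin n) ℝ)
    (hX : ∀ u : Fin n → ℝ, u ≠ 0 → ¬ ∀ i : Fin (n + 1), 0 ≤ (-1) ^ (i : ℕ) * (X *ᵥ u) i)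
    (k l : Fin (n + 1)) (hk : (X.submatrix k.succAbove id).det ≠ 0) :
    0 < (X.submatrix k.succAbove id).det * (X.submatrix l.succAbove id).det := by
  by_cases hkl : l = k
  · subst hkl
    exact mul_self_pos.2 hk
  obtain ⟨q, hq⟩ := Fin.exists_succAbove_eq hkl
  set K := X.submatrix k.succAbove id with hK
  set u : Fin n → ℝ := K⁻¹ *ᵥ Pi.single q ((-1) ^ (l : ℕ)) with hu
  have hKu : K *ᵥ u = Pi.single q ((-1) ^ (l : ℕ)) := by
    rw [hu, mulVec_mulVec, mul_nonsing_inv _ (isUnit_iff_ne_zero.2 hk), one_mulVec]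
  have hyk : ∀ p, (X *ᵥ u) (k.succAbove p) = (Pi.single q ((-1) ^ (l : ℕ)) : Fin n → ℝ) p := by
    intro p
    rw [← hKu]
    rfl
  have hu0 : u ≠ 0 := by
    intro h
    have := hyk q
    rw [h] at this
    simp at this
    exact pow_ne_zero _ (by norm_num) this.symm
  have hsq : ∀ m : ℕ, ((-1 : ℝ) ^ m) * (-1) ^ m = 1 := fun m => by rw [← mul_pow]; simp
  have hneg : (-1) ^ (k : ℕ) * (X *ᵥ u) k < 0 := by
    by_contra hcon
    refine hX u hu0 fun i => ?_
    by_cases hi : i = k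
    · rw [hi]; exact not_lt.1 hcon
    · obtain ⟨p, rfl⟩ := Fin.exists_succAbove_eq hi
      rw [hyk]
      by_cases hp : p = q
      · subst hp
        rw [Pi.single_eq_same, hq, hsq]
        exact zero_le_one
      · rw [Pi.single_eq_of_ne hp, mul_zero]
  have hrel : ∑ i : Fin (n + 1), (-1) ^ (i : ℕ) * (X *ᵥ u) i *
      (X.submatrix i.succAbove id).det = 0 := by
    have hdet : (Matrix.of fun i j => (Fin.cons ((X *ᵥ u) i) (X i) : Fin (n + 1) → ℝ) j).det
        = 0 := by
      rw [← exists_mulVec_eq_zero_iff]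
      refine ⟨Fin.cons (-1) u, fun h => ?_, ?_⟩
      · have := congrFun h 0
        simp at this
      · ext i
        simp [mulVec, dotProduct, Fin.sum_univ_succ]
    rw [det_succ_column_zero] at hdet
    rw [← hdet]
    refine Finset.sum_congr rfl fun i _ => ?_
    congr 2
  rw [Fin.sum_univ_succAbove _ k, Finset.sum_eq_single q] at hrel
  · rw [hyk, Pi.single_eq_same, hq, hsq, one_mul] at hrel
    have h2 := mul_self_pos.2 hk
    have h3 : (X.submatrix l.succAbove id).det =
        -((-1) ^ (k : ℕ) * (X *ᵥ u) k * K.det) := by linarith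
    rw [h3]
    nlinarith [mul_pos_of_neg_of_neg hneg (neg_neg_of_pos h2)]
  · intro p _ hp
    rw [hyk, Pi.single_eq_of_ne hp]
    simp
  · simp

theorem Mrt_one {n : ℕ} (A : Matrix (Fin n) (Fin n) ℝ) (c : Fin n → ℝ) (r : ℕ) :
    Mrt A c r 1 = obsMat A c n := by
  ext i j
  simp [Mrt, obsMat]

theorem not_weakly_alternating_of_obsSVB {n : ℕ} (hn : 0 < n) {A : Matrix (Fin n) (Fin n) ℝ}
    {c : Fin n → ℝ} (h : ObsSVB A c (n - 1)) {f : Fin (n + 1) → ℕ} (hf : StrictMono f)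
    {u : Fin n → ℝ} (hu : u ≠ 0) :
    ¬ ∀ i : Fin (n + 1), 0 ≤ (-1) ^ (i : ℕ) * ((c ᵥ* A ^ f i) ⬝ᵥ u) := by
  intro hcon
  have hlt : ∀ i, f i < f (Fin.last n) + 1 := fun i =>
    Nat.lt_succ_of_le (hf.monotone (Fin.le_last i))
  have hvar : variation u ≤ ((n - 1 : ℕ) : ℤ) := by
    unfold variation
    split_ifs with h0
    · omega
    · have hle : ((List.ofFn u).filter fun x => decide (x ≠ 0)).length ≤ n := by
        simpa using List.length_filter_le (fun x => decide (x ≠ 0)) (List.ofFn u)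
      have := signChanges_add_one_le_length h0
      omega
  have h1 := h (f (Fin.last n) + 1) (Nat.succ_pos _) u hu hvar
  have h2 := le_maxVariation_of_weakly_alternating (obsMat A c (f (Fin.last n) + 1) *ᵥ u)
    (fun i => ⟨f i, hlt i⟩) (fun i j hij => hf hij) hcon
  omega

theorem det_Mrt_pos_of_obsSVB {n : ℕ} {A : Matrix (Fin n) (Fin n) ℝ} {c : Fin n → ℝ}
    (hobs : Observable A c) (h : ObsSVB A c (n - 1)) {r : ℕ} (hr : 1 ≤ r) (hrn : r ≤ n) (t : ℕ) :
    0 < (obsMat A c n).det * (Mrt A c r (t + 1)).det := by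
  induction t with
  | zero =>
    rw [zero_add, Mrt_one]
    exact mul_self_pos.2 hobs
  | succ t ih =>
    set g : Fin (n + 1) → ℕ := fun i => if (i : ℕ) < n - r then (i : ℕ) else (i : ℕ) + t with hg
    have hmono : StrictMono g := by
      intro i j hij
      have : (i : ℕ) < j := hij
      simp only [hg]
      split_ifs <;> omega
    set X : Matrix (Fin (n + 1)) (Fin n) ℝ := Matrix.of fun i => c ᵥ* A ^ g i with hX
    have hlast : X.submatrix (Fin.last n).succAbove id = Mrt A c r (t + 1) := by
      ext i j
      simp [hX, hg, Mrt]
    have hmid : X.submatrix (⟨n - r, by omega⟩ : Fin (n + 1)).succAbove id =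
        Mrt A c r (t + 1 + 1) := by
      ext i j
      simp only [hX, hg, Mrt, submatrix_apply, of_apply, id]
      refine congrArg (fun e => (c ᵥ* A ^ e) j) ?_
      by_cases hi : (i : ℕ) < n - r
      · rw [Fin.succAbove_of_castSucc_lt _ _ (by simpa [Fin.lt_def] using hi)]
        simp [hi]
      · rw [Fin.succAbove_of_le_castSucc _ _ (by simpa [Fin.le_def] using hi)]
        rw [Fin.val_succ, if_neg (by omega), if_neg hi]
        omega
    have key := det_mul_det_pos_of_not_weakly_alternating X
      (fun u hu => not_weakly_alternating_of_obsSVB (by omega) h hmono hu)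
      (Fin.last n) ⟨n - r, by omega⟩ (by rw [hlast]; exact right_ne_zero_of_mul ih.ne')
    rw [hlast, hmid] at key
    have h2 := mul_self_pos.2 (right_ne_zero_of_mul ih.ne')
    by_contra hcon
    nlinarith [mul_pos ih key, mul_nonneg (neg_nonneg.2 (not_lt.1 hcon)) h2.le]

theorem det_pos_of_det_Mrt {n : ℕ} {A : Matrix (Fin n) (Fin n) ℝ} {c : Fin n → ℝ}
    (hn : 0 < n)
    (h : ∀ r ∈ Finset.Icc 1 n, ∀ t : ℕ, 1 ≤ t → 0 < (obsMat A c n).det * (Mrt A c r t).det) :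
    0 < A.det := by
  have h1 := h n (Finset.mem_Icc.2 ⟨hn, le_rfl⟩) 2 (by omega)
  have h2 : Mrt A c n 2 = obsMat A c n * A := by
    ext i j
    simp only [Mrt, obsMat, Nat.sub_self, Nat.not_lt_zero, if_false, of_apply]
    rw [show (i : ℕ) + 2 - 1 = i + 1 by omega, pow_succ, ← vecMul_vecMul]
    rfl
  rw [h2, det_mul, ← mul_assoc] at h1
  exact pos_of_mul_pos_right h1 (mul_self_nonneg _)

/-- The trailing minors of the coordinates of the rows `c Aˢ` with respect to the rows of the
observability matrix are quotients of determinants. -/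
theorem det_coordinates {k r : ℕ} (A : Matrix (Fin (k + r)) (Fin (k + r)) ℝ)
    (c : Fin (k + r) → ℝ) (hobs : Observable A c) (t : ℕ) :
    (Mrt A c r t).det = (Matrix.of fun i j : Fin r =>
      ((c ᵥ* A ^ (k + i + t - 1)) ᵥ* (obsMat A c (k + r))⁻¹) (Fin.natAdd k j)).det *
        (obsMat A c (k + r)).det := by
  have hunit : IsUnit (obsMat A c (k + r)).det := isUnit_iff_ne_zero.2 hobs
  have h1 : Mrt A c r t =
      (Mrt A c r t * (obsMat A c (k + r))⁻¹) * obsMat A c (k + r) := by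
    rw [Matrix.mul_assoc, nonsing_inv_mul _ hunit, Matrix.mul_one]
  have hrow : ∀ i, (Mrt A c r t * (obsMat A c (k + r))⁻¹) i =
      (c ᵥ* A ^ (if (i : ℕ) < k + r - r then (i : ℕ) else (i : ℕ) + t - 1)) ᵥ*
        (obsMat A c (k + r))⁻¹ := fun i => rfl
  have hid : ∀ i : Fin (k + r), (c ᵥ* A ^ (i : ℕ)) ᵥ* (obsMat A c (k + r))⁻¹ =
      (1 : Matrix (Fin (k + r)) (Fin (k + r)) ℝ) i := by
    intro i
    rw [← mul_nonsing_inv _ hunit]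
    rfl
  rw [h1, det_mul]
  congr 1
  rw [← det_submatrix_equiv_self finSumFinEquiv]
  have hblock : (Mrt A c r t * (obsMat A c (k + r))⁻¹).submatrix
      finSumFinEquiv finSumFinEquiv = fromBlocks 1 0
        (Matrix.of fun (i : Fin r) (j : Fin k) =>
          ((c ᵥ* A ^ (k + i + t - 1)) ᵥ* (obsMat A c (k + r))⁻¹) (Fin.castAdd r j))
        (Matrix.of fun i j : Fin r =>
          ((c ᵥ* A ^ (k + i + t - 1)) ᵥ* (obsMat A c (k + r))⁻¹) (Fin.natAdd k j)) := by
    ext i j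
    rcases i with i | i
    · have hi := hid (Fin.castAdd r i)
      rw [Fin.val_castAdd] at hi
      rcases j with j | j
      · simp [hrow, hi, one_apply]
      · simp [hrow, hi, one_apply, Fin.ext_iff]
        omega
    · rcases j with j | j <;> simp [hrow]
  rw [hblock, det_fromBlocks_zero₁₂, det_one, one_mul]

theorem eq_zero_of_weakly_alternating {n : ℕ} {A : Matrix (Fin n) (Fin n) ℝ} {c : Fin n → ℝ}
    (hn : 0 < n) (hobs : Observable A c)
    (h : ∀ r ∈ Finset.Icc 1 n, ∀ t : ℕ, 1 ≤ t → 0 < (obsMat A c n).det * (Mrt A c r t).det)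
    {u : Fin n → ℝ} {f : Fin (n + 1) → ℕ} (hf : StrictMono f)
    (hfu : ∀ i : Fin (n + 1), 0 ≤ (-1) ^ (i : ℕ) * ((c ᵥ* A ^ f i) ⬝ᵥ u)) : u = 0 := by
  have hunit : IsUnit (obsMat A c n).det := isUnit_iff_ne_zero.2 hobs
  have hA : IsUnit (A ^ (n - 1)).det := by
    rw [det_pow]
    exact isUnit_iff_ne_zero.2 (pow_ne_zero _ (det_pos_of_det_Mrt hn h).ne')
  set x : Fin n → ℝ := (A ^ (n - 1))⁻¹ *ᵥ u with hx
  have hxu : A ^ (n - 1) *ᵥ x = u := by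
    rw [hx, mulVec_mulVec, mul_nonsing_inv _ hA, one_mulVec]
  set b : Fin n → ℝ := obsMat A c n *ᵥ x with hb
  have hbx : (obsMat A c n)⁻¹ *ᵥ b = x := by
    rw [hb, mulVec_mulVec, nonsing_inv_mul _ hunit, one_mulVec]
  set U : ℕ → ℕ → ℝ := fun j s => if hj : j < n then
    ((c ᵥ* A ^ (s + (n - 1))) ᵥ* (obsMat A c n)⁻¹) (Fin.rev ⟨j, hj⟩) else 0 with hU
  set a : ℕ → ℝ := fun j => if hj : j < n then b (Fin.rev ⟨j, hj⟩) else 0 with ha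
  have hsum : ∀ s, ∑ j ∈ Finset.range n, a j * U j s = (c ᵥ* A ^ s) ⬝ᵥ u := by
    intro s
    rw [← hxu, dotProduct_mulVec, vecMul_vecMul, ← pow_add, ← hbx, dotProduct_mulVec,
      Finset.sum_range]
    refine Fintype.sum_equiv Fin.revPerm _ _ fun j => ?_
    simp only [hU, ha, dif_pos j.2, Fin.eta, Fin.revPerm_apply]
    exact mul_comm _ _
  have hpos : ∀ r ≤ n, ∀ s, 0 < (Matrix.of fun i j : Fin r => U (j.rev : ℕ) (s + i)).det := by
    intro r hr s
    rcases Nat.eq_zero_or_pos r with rfl | hr0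
    · simp
    obtain ⟨k, rfl⟩ := Nat.exists_eq_add_of_le' hr
    have h1 := h r (Finset.mem_Icc.2 ⟨hr0, hr⟩) (s + r) (by omega)
    rw [det_coordinates A c hobs] at h1
    have h2 : (Matrix.of fun i j : Fin r => U (j.rev : ℕ) (s + i)) =
        Matrix.of fun i j : Fin r => ((c ᵥ* A ^ (k + i + (s + r) - 1)) ᵥ*
          (obsMat A c (k + r))⁻¹) (Fin.natAdd k j) := by
      ext i j
      have hj : (j.rev : ℕ) < k + r := by omega
      simp only [of_apply, hU, dif_pos hj]
      congr 1
      · congr 3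
        omega
      · ext
        simp [Fin.val_rev]
        omega
    rw [h2]
    have h3 := mul_self_pos.2 hobs
    by_contra hcon
    nlinarith [mul_nonneg (neg_nonneg.2 (not_lt.1 hcon)) h3.le]
  set f' : ℕ → ℕ := fun k => if hk : k < n + 1 then f ⟨k, hk⟩ else 0 with hf'
  have hzero := coeff_eq_zero_of_weakly_alternating n U hpos a f'
    (fun k hk => by
      simp only [hf', dif_pos (show k < n + 1 by omega), dif_pos (show k + 1 < n + 1 by omega)]
      exact hf (by simp [Fin.lt_def]))
    (fun k hk => by
      rw [hsum]
      simp only [hf', dif_pos (show k < n + 1 by omega)]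
      exact hfu ⟨k, by omega⟩)
  have hb0 : b = 0 := by
    ext j
    have := hzero j.rev j.rev.2
    simpa only [ha, dif_pos j.rev.2, Pi.zero_apply, Fin.eta, Fin.rev_rev] using this
  rw [← hxu, ← hbx, hb0, mulVec_zero, mulVec_zero]

/-- the observability operator of an observable pair `(A,c)` is strictly
`(n-1)`-variation bounding iff `det(O_n) * det(M_r[t]) > 0` for all `r ∈ {1,…,n}`, `t ≥ 1`. -/
theorem stmt0 {n : ℕ} (A : Matrix (Fin n) (Fin n) ℝ) (c : Fin n → ℝ)
    (hobs : Observable A c) :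
    ObsSVB A c (n - 1) ↔
      ∀ r ∈ Finset.Icc 1 n, ∀ t : ℕ, 1 ≤ t →
        0 < (obsMat A c n).det * (Mrt A c r t).det := by
  rcases Nat.eq_zero_or_pos n with rfl | hn
  · refine ⟨fun _ r hr => ?_, fun _ t _ u hu => absurd (Subsingleton.elim u 0) hu⟩
    rw [Finset.mem_Icc] at hr
    omega
  constructor
  · intro h r hr t ht
    obtain ⟨t, rfl⟩ := Nat.exists_eq_add_of_le' ht
    rw [Finset.mem_Icc] at hr
    exact det_Mrt_pos_of_obsSVB hobs h hr.1 hr.2 t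
  · intro h t ht u hu _
    refine (maxVariation_le_sub_one_of_forall (n := n) _ ht fun σ f hσ hf hcon => ?_).trans (by omega)
    refine smul_ne_zero hσ hu (eq_zero_of_weakly_alternating hn hobs h
      (f := fun i => (f i : ℕ)) (fun i j hij => hf hij) fun i => ?_)
    rw [dotProduct_smul, smul_eq_mul]
    exact hcon i
end

section
/- Let X be a real n×m matrix and let k be a positive integer with k ≤ m and k ≤ n−1. Then X is strictly k-sign consistent if and only if X is strictly (k−1)-variation bounding. -/
open Matrix Polynomial Filter

/-- `u` has a subvector of length `d` whose entries are nonzero with alternating signs. -/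
def StrictlyAlternates {m : ℕ} (d : ℕ) (u : Fin m → ℝ) : Prop :=
  ∃ f : Fin d → Fin m, StrictMono f ∧ ∃ ε : ℝ, ε ≠ 0 ∧ ∀ j : Fin d, 0 < ε * (-1) ^ (j : ℕ) * u (f j)

/-- `u` has a subvector of length `d` whose entries, up to zeros, have alternating signs. -/
def WeaklyAlternates {m : ℕ} (d : ℕ) (u : Fin m → ℝ) : Prop :=
  ∃ f : Fin d → Fin m, StrictMono f ∧ ∃ ε : ℝ, ε ≠ 0 ∧ ∀ j : Fin d, 0 ≤ ε * (-1) ^ (j : ℕ) * u (f j)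

/-! ### Strictly increasing selections -/

theorem exists_strictMono_comp_succAbove {k n : ℕ} (hkn : k < n) {f : Fin k → Fin n}
    (hf : StrictMono f) :
    ∃ (F : Fin (k + 1) → Fin n) (p : Fin (k + 1)), StrictMono F ∧ F ∘ p.succAbove = f := by
  classical
  obtain ⟨a, ha⟩ : ∃ a, a ∉ Finset.univ.image f := by
    by_contra! h
    have h1 := Finset.card_le_card (fun x _ => h x : (Finset.univ : Finset (Fin n)) ⊆ _)
    have h2 := Finset.card_image_le (s := Finset.univ) (f := f)
    simp only [Finset.card_univ, Fintype.card_fin] at h1 h2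
    omega
  have hc : (insert a (Finset.univ.image f)).card = k + 1 := by
    rw [Finset.card_insert_of_notMem ha, Finset.card_image_of_injective _ hf.injective]
    simp
  have hr := Finset.range_orderEmbOfFin _ hc
  obtain ⟨p, hp⟩ : a ∈ Set.range ((insert a (Finset.univ.image f)).orderEmbOfFin hc) := by
    rw [hr]; simp
  refine ⟨_, p, (Finset.orderEmbOfFin _ hc).strictMono, ?_⟩
  refine (StrictMono.range_inj
    ((Finset.orderEmbOfFin _ hc).strictMono.comp (Fin.strictMono_succAbove p)) hf).1 ?_
  rw [Set.range_comp, Fin.range_succAbove, Set.image_compl_eq_range_sdiff_image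
    (Finset.orderEmbOfFin _ hc).injective, hr]
  ext x
  simp only [Set.image_singleton, hp, Finset.coe_insert, Finset.coe_image, Finset.coe_univ,
    Set.image_univ, Set.mem_sdiff, Set.mem_insert_iff, Set.mem_singleton_iff]
  constructor
  · tauto
  · intro hx
    refine ⟨Or.inr hx, ?_⟩
    rintro rfl
    exact ha (by simpa using hx)

/-- A nonvanishing function of increasing `k`-tuples whose sign is unchanged when one index is
exchanged has constant sign. -/
theorem mul_pos_of_forall_exchange {k n : ℕ} (D : (Fin k → Fin n) → ℝ)
    (h0 : ∀ f, StrictMono f → D f ≠ 0)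
    (h1 : ∀ f : Fin (k + 1) → Fin n, StrictMono f →
      ∀ i j : Fin (k + 1), 0 < D (f ∘ i.succAbove) * D (f ∘ j.succAbove))
    {f g : Fin k → Fin n} (hf : StrictMono f) (hg : StrictMono g) : 0 < D f * D g := by
  classical
  obtain ⟨r, hr⟩ : ∃ r, (Finset.univ.image f \ Finset.univ.image g).card = r := ⟨_, rfl⟩
  induction r using Nat.strong_induction_on generalizing f with
  | _ r ih =>
  have hcf : (Finset.univ.image f).card = k := by
    simp [Finset.card_image_of_injective _ hf.injective]
  have hcg : (Finset.univ.image g).card = k := by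
    simp [Finset.card_image_of_injective _ hg.injective]
  by_cases hsub : Finset.univ.image f ⊆ Finset.univ.image g
  · have he := Finset.eq_of_subset_of_card_le hsub (by omega)
    have : f = g := by
      refine (StrictMono.range_inj hf hg).1 ?_
      simpa using congrArg (fun s : Finset (Fin n) => (s : Set (Fin n))) he
    subst this
    exact mul_self_pos.2 (h0 f hf)
  · have hsub' : ¬ Finset.univ.image g ⊆ Finset.univ.image f := fun h =>
      hsub (Finset.eq_of_subset_of_card_le h (by omega)).ge
    obtain ⟨a, haf, hag⟩ := Finset.not_subset.1 hsub
    obtain ⟨b, hbg, hbf⟩ := Finset.not_subset.1 hsub'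
    have hc : (insert b (Finset.univ.image f)).card = k + 1 := by
      rw [Finset.card_insert_of_notMem hbf, hcf]
    set F := (insert b (Finset.univ.image f)).orderEmbOfFin hc with hF
    have hrF : Set.range F = _ := Finset.range_orderEmbOfFin _ hc
    obtain ⟨p, hp⟩ : b ∈ Set.range F := by rw [hrF]; simp
    obtain ⟨q, hq⟩ : a ∈ Set.range F := by
      rw [hrF]; exact Finset.mem_coe.2 (Finset.mem_insert_of_mem haf)
    have hpf : F ∘ p.succAbove = f := by
      refine (StrictMono.range_inj (F.strictMono.comp (Fin.strictMono_succAbove p)) hf).1 ?_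
      rw [Set.range_comp, Fin.range_succAbove, Set.image_compl_eq_range_sdiff_image F.injective, hrF]
      ext x
      simp only [Set.image_singleton, hp, Finset.coe_insert, Finset.coe_image, Finset.coe_univ,
        Set.image_univ, Set.mem_sdiff, Set.mem_insert_iff, Set.mem_singleton_iff]
      constructor
      · tauto
      · intro hx
        refine ⟨Or.inr hx, ?_⟩
        rintro rfl
        exact hbf (by simpa using hx)
    have hqm : StrictMono (F ∘ q.succAbove) := F.strictMono.comp (Fin.strictMono_succAbove q)
    have himg : Finset.univ.image (F ∘ q.succAbove) = (insert b (Finset.univ.image f)).erase a := by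
      rw [← Finset.coe_inj]
      simp only [Finset.coe_image, Finset.coe_univ, Set.image_univ]
      rw [Set.range_comp, Fin.range_succAbove, Set.image_compl_eq_range_sdiff_image F.injective, hrF]
      simp [hq]
    have hlt : (Finset.univ.image (F ∘ q.succAbove) \ Finset.univ.image g).card < r := by
      rw [himg, ← hr]
      refine Finset.card_lt_card (Finset.ssubset_iff_subset_ne.2 ⟨?_, ?_⟩)
      · intro x hx
        simp only [Finset.mem_sdiff, Finset.mem_erase, Finset.mem_insert] at hx ⊢
        refine ⟨?_, hx.2⟩
        rcases hx.1.2 with rfl | h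
        · exact absurd hbg hx.2
        · exact h
      · intro h
        have : a ∈ Finset.univ.image f \ Finset.univ.image g := Finset.mem_sdiff.2 ⟨haf, hag⟩
        rw [← h] at this
        simp at this
    have e1 := ih _ hlt hqm rfl
    have e2 := h1 F F.strictMono p q
    rw [hpf] at e2
    have e3 := mul_pos e2 e1
    have e4 : D f * D (F ∘ q.succAbove) * (D (F ∘ q.succAbove) * D g)
        = D (F ∘ q.succAbove) ^ 2 * (D f * D g) := by ring
    rw [e4] at e3
    exact pos_of_mul_pos_right e3 (sq_nonneg _)

/-! ### Determinant identities -/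

theorem sum_alternating_mulVec_mul_det {k : ℕ} (M : Matrix (Fin (k + 1)) (Fin k) ℝ)
    (s : Fin k → ℝ) :
    ∑ j : Fin (k + 1), (-1) ^ (j : ℕ) * (M *ᵥ s) j * (M.submatrix j.succAbove id).det = 0 := by
  let A : Matrix (Fin (k + 1)) (Fin (k + 1)) ℝ := Matrix.of fun i => Fin.cons ((M *ᵥ s) i) (M i)
  have hA : A.det = 0 := by
    rw [← Matrix.exists_mulVec_eq_zero_iff]
    refine ⟨Fin.cons (-1) s, fun h => ?_, ?_⟩
    · have := congrFun h 0
      simp at this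
    · ext i
      simp [A, Matrix.mulVec, dotProduct, Fin.sum_univ_succ]
  rw [Matrix.det_succ_column_zero] at hA
  rw [← hA]
  rfl

theorem mulVec_alternating_det_eq_zero {k : ℕ} (N : Matrix (Fin k) (Fin (k + 1)) ℝ) :
    N *ᵥ (fun l => (-1) ^ (l : ℕ) * (N.submatrix id l.succAbove).det) = 0 := by
  ext r
  let A : Matrix (Fin (k + 1)) (Fin (k + 1)) ℝ := Matrix.of (Fin.cons (N r) N)
  have hA : A.det = 0 := by
    refine Matrix.det_zero_of_row_eq (i := 0) (j := r.succ) (Fin.succ_ne_zero r).symm ?_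
    rfl
  rw [Matrix.det_succ_row_zero] at hA
  rw [Pi.zero_apply, ← hA]
  change ∑ l : Fin (k + 1), N r l * ((-1) ^ (l : ℕ) * _) = _
  refine Finset.sum_congr rfl fun l _ => ?_
  rw [mul_left_comm, ← mul_assoc]
  rfl

theorem det_mul_eq_sum_prod {k m : ℕ} (A : Matrix (Fin k) (Fin m) ℝ)
    (W : Matrix (Fin m) (Fin k) ℝ) :
    (A * W).det = ∑ r : Fin k → Fin m, (∏ c, W (r c) c) * (A.submatrix id r).det := by
  rw [← Matrix.det_transpose]
  have h : (A * W)ᵀ = fun c => ∑ j, W j c • Aᵀ j := by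
    ext c i
    simp [Matrix.mul_apply, Finset.sum_apply, mul_comm]
  rw [h]
  change Matrix.detRowAlternating.toMultilinearMap (fun c => ∑ j, W j c • Aᵀ j) = _
  rw [MultilinearMap.map_sum]
  refine Finset.sum_congr rfl fun r _ => ?_
  rw [MultilinearMap.map_smul_univ, smul_eq_mul, ← Matrix.det_transpose (A.submatrix id r)]
  rfl

/-- The matrix whose column `c` carries the weights `w` on the block `b ⁻¹' {c}`. -/
def blockWeights {k m : ℕ} (b : Fin m → Fin k) (w : Fin m → ℝ) : Matrix (Fin m) (Fin k) ℝ :=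
  Matrix.of fun j c => if b j = c then w j else 0

theorem det_mul_blockWeights_pos {k m : ℕ} {b : Fin m → Fin k} {w : Fin m → ℝ}
    (hb : Monotone b) (hw : ∀ j, 0 ≤ w j) (hbw : ∀ c, ∃ j, b j = c ∧ 0 < w j) (σ : ℝ)
    (A : Matrix (Fin k) (Fin m) ℝ)
    (hA : ∀ g : Fin k → Fin m, StrictMono g → 0 < σ * (A.submatrix id g).det) :
    0 < σ * (A * blockWeights b w).det := by
  have hmono : ∀ r : Fin k → Fin m, (∀ c, b (r c) = c) → StrictMono r := by
    intro r hr c d hcd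
    by_contra! h
    have := hb h
    rw [hr, hr] at this
    exact absurd hcd this.not_gt
  rw [det_mul_eq_sum_prod, Finset.mul_sum]
  choose r hr hr' using hbw
  refine Finset.sum_pos' (fun r _ => ?_) ⟨r, Finset.mem_univ _, ?_⟩
  · by_cases h : ∀ c, b (r c) = c
    · rw [mul_left_comm]
      refine mul_nonneg (Finset.prod_nonneg fun c _ => ?_) (hA r (hmono r h)).le
      simp [blockWeights, h, hw]
    · push Not at h
      obtain ⟨c, hc⟩ := h
      rw [Finset.prod_eq_zero (Finset.mem_univ c) (by simp [blockWeights, hc])]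
      simp
  · rw [mul_left_comm]
    refine mul_pos (Finset.prod_pos fun c _ => ?_) (hA r (hmono r hr))
    simp [blockWeights, hr, hr']

theorem mulVec_extend_apply {k n m : ℕ} (X : Matrix (Fin n) (Fin m) ℝ) {g : Fin k → Fin m}
    (hg : Function.Injective g) (s : Fin k → ℝ) (i : Fin n) :
    (X *ᵥ Function.extend g s 0) i = ((X.submatrix id g) *ᵥ s) i := by
  symm
  refine Fintype.sum_of_injective g hg _ _ (fun j hj => ?_) (fun c => ?_)
  · rw [Function.extend_apply' _ _ _ (by simpa using hj)]
    simp
  · simp [hg.extend_apply]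

/-! ### From sign consistency to variation bounds -/

theorem exists_monotone_surjective_refining {k m : ℕ} (hk : 0 < k) (hkm : k ≤ m) (b₀ : Fin m → ℕ)
    (hmono : Monotone b₀) (hid : ∀ j, b₀ j ≤ j) (hlt : ∀ j, b₀ j < k)
    (hstep : ∀ i j : Fin m, (j : ℕ) = i + 1 → b₀ j ≤ b₀ i + 1) :
    ∃ b : Fin m → Fin k, Monotone b ∧ Function.Surjective b ∧
      ∀ i j, b i = b j → b₀ i = b₀ j := by
  refine ⟨fun j => ⟨max (b₀ j) (j - (m - k)), by have := hlt j; omega⟩, ?_, ?_, ?_⟩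
  · intro i j hij
    have h1 := hmono hij
    have h2 : (i : ℕ) ≤ j := hij
    simp only [Fin.mk_le_mk]
    omega
  · intro c
    classical
    have hex : ∃ i : ℕ, ∃ hi : i < m, (c : ℕ) ≤ max (b₀ ⟨i, hi⟩) (i - (m - k)) :=
      ⟨m - 1, by omega, by omega⟩
    obtain ⟨hi, hc⟩ := Nat.find_spec hex
    have hmin := fun {l} => Nat.find_min (m := l) hex
    generalize Nat.find hex = i at hi hc hmin
    refine ⟨⟨i, hi⟩, Fin.ext ?_⟩
    simp only
    rcases i with _ | i
    · have := hid ⟨0, hi⟩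
      simp only at this
      omega
    · have h1 := hmin (Nat.lt_succ_self i)
      push Not at h1
      have h2 := h1 (by omega)
      have h3 := hstep ⟨i, by omega⟩ ⟨i + 1, hi⟩ rfl
      omega
  · have key : ∀ i j : Fin m, i ≤ j →
        max (b₀ i) (i - (m - k)) = max (b₀ j) (j - (m - k)) → b₀ i = b₀ j := by
      intro i j hij h
      rcases hij.eq_or_lt with rfl | hij'
      · rfl
      · have h1 := hmono hij
        have h2 : (i : ℕ) < j := hij'
        omega
    intro i j h
    simp only [Fin.mk.injEq] at h
    rcases le_total i j with hij | hij
    · exact key i j hij h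
    · exact (key j i hij h.symm).symm

/-- `u` has a strictly alternating subvector of length `d + 1` with indices at most `j`. -/
def StrictlyAlternatesUpTo {m : ℕ} (u : Fin m → ℝ) (d : ℕ) (j : Fin m) : Prop :=
  ∃ f : Fin (d + 1) → Fin m, StrictMono f ∧ f (Fin.last d) ≤ j ∧
    ∃ ε : ℝ, ε ≠ 0 ∧ ∀ i : Fin (d + 1), 0 < ε * (-1) ^ (i : ℕ) * u (f i)

theorem StrictlyAlternatesUpTo.le {m d : ℕ} {u : Fin m → ℝ} {j : Fin m}
    (h : StrictlyAlternatesUpTo u d j) : d ≤ j := by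
  obtain ⟨f, hf, hl, -⟩ := h
  have h1 : ∀ i : ℕ, ∀ hi : i < d + 1, i ≤ (f ⟨i, hi⟩ : ℕ) := by
    intro i
    induction i with
    | zero => simp
    | succ i ih =>
      intro hi
      have h2 := ih (by omega)
      have h3 : (f ⟨i, by omega⟩ : ℕ) < f ⟨i + 1, hi⟩ := hf (by simp)
      omega
  exact (h1 d (by omega)).trans hl

theorem StrictlyAlternatesUpTo.snoc {m d : ℕ} {u : Fin m → ℝ} {f : Fin (d + 1) → Fin m}
    (hf : StrictMono f) {ε : ℝ} (hε : ε ≠ 0) (h : ∀ i : Fin (d + 1), 0 < ε * (-1) ^ (i : ℕ) * u (f i))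
    {j : Fin m} (hj : f (Fin.last d) < j) (hu : ε * (-1) ^ d * u j < 0) :
    StrictlyAlternatesUpTo u (d + 1) j := by
  refine ⟨Fin.snoc f j, ?_, by simp, ε, hε, ?_⟩
  · rw [Fin.strictMono_iff_lt_succ]
    intro i
    induction i using Fin.lastCases with
    | last => simpa using hj
    | cast i =>
      rw [Fin.snoc_castSucc, ← Fin.castSucc_succ, Fin.snoc_castSucc]
      exact hf (Fin.castSucc_lt_succ)
  · intro i
    induction i using Fin.lastCases with
    | last =>
      simp only [Fin.snoc_last, Fin.val_last, pow_succ]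
      linarith
    | cast i => simpa using h i

theorem StrictlyAlternatesUpTo.pred {m d : ℕ} {u : Fin m → ℝ} {i j : Fin m}
    (hij : (j : ℕ) = i + 1) (h : StrictlyAlternatesUpTo u (d + 1) j) :
    StrictlyAlternatesUpTo u d i := by
  obtain ⟨f, hf, hl, ε, hε, h⟩ := h
  refine ⟨f ∘ Fin.castSucc, hf.comp Fin.strictMono_castSucc, ?_, ε, hε, fun i => ?_⟩
  · have h1 : f (Fin.castSucc (Fin.last d)) < f (Fin.last (d + 1)) := hf (Fin.castSucc_lt_last _)
    simp only [Fin.le_def, Fin.lt_def, Function.comp] at *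
    omega
  · simpa using h i.castSucc

theorem exists_block_signs {k m : ℕ} (hk : 0 < k) (hkm : k ≤ m) {u : Fin m → ℝ}
    (hu : ¬ StrictlyAlternates (k + 1) u) :
    ∃ b : Fin m → Fin k, Monotone b ∧ Function.Surjective b ∧
      ∀ i j, b i = b j → 0 ≤ u i * u j := by
  classical
  have hk' : ∀ j, ¬ StrictlyAlternatesUpTo u k j := fun j ⟨f, hf, _, h⟩ => hu ⟨f, hf, h⟩
  let b₀ : Fin m → ℕ := fun j => Nat.findGreatest (fun d => StrictlyAlternatesUpTo u d j) k
  have hspec : ∀ j, b₀ j ≠ 0 → StrictlyAlternatesUpTo u (b₀ j) j := fun j h =>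
    Nat.findGreatest_of_ne_zero (P := fun d => StrictlyAlternatesUpTo u d j) rfl h
  have hlt : ∀ j, b₀ j < k := by
    intro j
    refine lt_of_le_of_ne (Nat.findGreatest_le k) fun h => ?_
    have := hspec j (by omega)
    rw [h] at this
    exact hk' j this
  have hge : ∀ {d j}, d ≤ k → StrictlyAlternatesUpTo u d j → d ≤ b₀ j := fun hd h =>
    Nat.le_findGreatest hd h
  have hmono : Monotone b₀ := by
    intro i j hij
    by_cases h0 : b₀ i = 0
    · omega
    · obtain ⟨f, hf, hl, h⟩ := hspec i h0
      exact hge (hlt i).le ⟨f, hf, hl.trans hij, h⟩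
  have hsep : ∀ i j, i < j → u i * u j < 0 → b₀ i < b₀ j := by
    intro i j hij huij
    have hui : u i ≠ 0 := by rintro h; simp [h] at huij
    have h1 : StrictlyAlternatesUpTo u (b₀ i) i := by
      by_cases h0 : b₀ i = 0
      · rw [h0]
        refine ⟨fun _ => i, Subsingleton.strictMono (α := Fin 1) _, le_rfl, u i, hui, fun c => ?_⟩
        rw [Subsingleton.elim (α := Fin 1) c 0]
        simpa using mul_self_pos.2 hui
      · exact hspec i h0
    obtain ⟨f, hf, hl, ε, hε, h⟩ := h1
    have hlast := h (Fin.last _)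
    rw [Fin.val_last] at hlast
    set s := ε * (-1) ^ (b₀ i) with hs
    have hs0 : s ≠ 0 := by rintro h'; simp [h'] at hlast
    rcases lt_or_ge (s * u j) 0 with hj | hj
    · exact hge (hlt i) (StrictlyAlternatesUpTo.snoc hf hε h (hl.trans_lt hij) hj)
    · have hi : s * u i < 0 := by
        by_contra! hc
        have e1 : (s * u i) * (s * u j) = s ^ 2 * (u i * u j) := by ring
        have e2 : 0 < s ^ 2 := by positivity
        nlinarith [mul_nonneg hc hj]
      have hne : f (Fin.last _) ≠ i := by
        intro he
        rw [he] at hlast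
        linarith
      have := hge (hlt i) (StrictlyAlternatesUpTo.snoc hf hε h (lt_of_le_of_ne hl hne) hi)
      omega
  have hid : ∀ j, b₀ j ≤ j := by
    intro j
    by_cases h0 : b₀ j = 0
    · omega
    · exact (hspec j h0).le
  have hstep : ∀ i j : Fin m, (j : ℕ) = i + 1 → b₀ j ≤ b₀ i + 1 := by
    intro i j hij
    rcases h0 : b₀ j with _ | d
    · omega
    · have h1 := hspec j (by omega)
      have h2 := hlt j
      rw [h0] at h1
      have := hge (by omega) (h1.pred hij)
      omega
  obtain ⟨b, hb, hsurj, hbb⟩ := exists_monotone_surjective_refining hk hkm b₀ hmono hid hlt hstep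
  refine ⟨b, hb, hsurj, fun i j hij => ?_⟩
  have he := hbb i j hij
  by_contra! hc
  rcases lt_trichotomy i j with h | rfl | h
  · exact absurd (hsep i j h hc) (by omega)
  · exact absurd hc (not_lt.2 (mul_self_nonneg _))
  · exact absurd (hsep j i h (by rwa [mul_comm])) (by omega)

theorem exists_eq_blockWeights_mulVec {k m : ℕ} (hk : 0 < k) (hkm : k ≤ m) {u : Fin m → ℝ}
    (hu : ¬ StrictlyAlternates (k + 1) u) :
    ∃ (b : Fin m → Fin k) (w : Fin m → ℝ) (s : Fin k → ℝ), Monotone b ∧ (∀ j, 0 ≤ w j) ∧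
      (∀ c, ∃ j, b j = c ∧ 0 < w j) ∧ u = blockWeights b w *ᵥ s := by
  obtain ⟨b, hb, hsurj, hsign⟩ := exists_block_signs hk hkm hu
  have hex : ∀ c, ∃ s : ℝ, (∃ j, b j = c ∧ (s = 0 ∨ 0 < u j / s)) ∧
      ∀ j, b j = c → (s = 0 → u j = 0) ∧ 0 ≤ u j / s := by
    intro c
    by_cases h : ∃ j, b j = c ∧ u j ≠ 0
    · obtain ⟨j, hj, hj0⟩ := h
      refine ⟨u j, ⟨j, hj, Or.inr (by rw [div_self hj0]; exact one_pos)⟩, fun i hi =>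
        ⟨fun h => absurd h hj0, ?_⟩⟩
      rw [← mul_div_mul_right _ _ hj0]
      exact div_nonneg (hsign i j (hi.trans hj.symm)) (mul_self_nonneg _)
    · push Not at h
      obtain ⟨j, hj⟩ := hsurj c
      exact ⟨0, ⟨j, hj, Or.inl rfl⟩, fun i hi => ⟨fun _ => h i hi, by simp⟩⟩
  choose s hs1 hs2 using hex
  refine ⟨b, fun j => if s (b j) = 0 then 1 else u j / s (b j), s, hb, fun j => ?_, fun c => ?_, ?_⟩
  · simp only
    split_ifs
    · exact zero_le_one
    · exact (hs2 _ j rfl).2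
  · obtain ⟨j, hj, h⟩ := hs1 c
    refine ⟨j, hj, ?_⟩
    simp only [hj]
    split_ifs with h0
    · exact one_pos
    · exact h.resolve_left h0
  · ext j
    simp only [blockWeights, Matrix.mulVec, dotProduct, Matrix.of_apply, ite_mul, zero_mul,
      Finset.sum_ite_eq, Finset.mem_univ, if_true]
    split_ifs with h0
    · rw [(hs2 _ j rfl).1 h0, h0, one_mul]
    · rw [div_mul_cancel₀ _ h0]

theorem not_weaklyAlternates_mulVec {n m k : ℕ} {X : Matrix (Fin n) (Fin m) ℝ} (hk : 0 < k)
    (hkm : k ≤ m) {σ : ℝ}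
    (hX : ∀ (f : Fin k → Fin n) (g : Fin k → Fin m), StrictMono f → StrictMono g →
      0 < σ * (X.submatrix f g).det)
    {u : Fin m → ℝ} (hu0 : u ≠ 0) (hu : ¬ StrictlyAlternates (k + 1) u) :
    ¬ WeaklyAlternates (k + 1) (X *ᵥ u) := by
  rintro ⟨f, hf, ε, hε, hy⟩
  obtain ⟨b, w, s, hb, hw, hbw, rfl⟩ := exists_eq_blockWeights_mulVec hk hkm hu
  set M := X.submatrix f id * blockWeights b w with hM
  have hMs : ∀ j, (M *ᵥ s) j = (X *ᵥ (blockWeights b w *ᵥ s)) (f j) := by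
    intro j
    rw [hM, ← Matrix.mulVec_mulVec]
    rfl
  have hdet : ∀ j : Fin (k + 1), 0 < σ * (M.submatrix j.succAbove id).det := fun j =>
    det_mul_blockWeights_pos hb hw hbw σ (X.submatrix (f ∘ j.succAbove) id) fun g hg =>
      hX _ g (hf.comp (Fin.strictMono_succAbove j)) hg
  have hsum : ∑ j : Fin (k + 1), (ε * (-1) ^ (j : ℕ) * (M *ᵥ s) j) *
      (σ * (M.submatrix j.succAbove id).det) = 0 := by
    have := congrArg (fun x => ε * σ * x) (sum_alternating_mulVec_mul_det M s)
    simp only [mul_zero, Finset.mul_sum] at this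
    rw [← this]
    exact Finset.sum_congr rfl fun j _ => by ring
  rw [Finset.sum_eq_zero_iff_of_nonneg
    (fun j _ => mul_nonneg (by rw [hMs]; exact hy j) (hdet j).le)] at hsum
  have hzero : ∀ j, (M *ᵥ s) j = 0 := by
    intro j
    have := hsum j (Finset.mem_univ j)
    simpa [hε, (hdet j).ne'] using this
  have hs : s = 0 := by
    refine Matrix.eq_zero_of_mulVec_eq_zero (M := M.submatrix (Fin.succAbove 0) id)
      (right_ne_zero_of_mul (hdet 0).ne') ?_
    ext j
    exact hzero _
  exact hu0 (by simp [hs])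

/-! ### From variation bounds to sign consistency -/

theorem weaklyAlternates_of_eq_zero {n k : ℕ} {y : Fin n → ℝ} {F : Fin (k + 1) → Fin n}
    (hF : StrictMono F) (p : Fin (k + 1)) (hy : ∀ j, y (F (p.succAbove j)) = 0) :
    WeaklyAlternates (k + 1) y := by
  have hz : ∀ j, j ≠ p → y (F j) = 0 := by
    intro j hj
    obtain ⟨z, rfl⟩ := Fin.exists_succAbove_eq hj
    exact hy z
  rcases le_total 0 (y (F p)) with h | h
  · refine ⟨F, hF, (-1) ^ (p : ℕ), by simp, fun j => ?_⟩
    by_cases hj : j = p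
    · subst hj
      simpa [← mul_pow] using h
    · simp [hz j hj]
  · refine ⟨F, hF, -(-1) ^ (p : ℕ), by simp, fun j => ?_⟩
    by_cases hj : j = p
    · subst hj
      simpa [← mul_pow] using h
    · simp [hz j hj]

theorem weaklyAlternates_of_comp_eq_zero {n k : ℕ} (hkn : k < n) {y : Fin n → ℝ}
    {f : Fin k → Fin n} (hf : StrictMono f) (hy : ∀ j, y (f j) = 0) :
    WeaklyAlternates (k + 1) y := by
  obtain ⟨F, p, hF, rfl⟩ := exists_strictMono_comp_succAbove hkn hf
  exact weaklyAlternates_of_eq_zero hF p hy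

theorem mem_range_of_extend_ne_zero {k m : ℕ} {g : Fin k → Fin m} {s : Fin k → ℝ} {j : Fin m}
    (h : Function.extend g s 0 j ≠ 0) : j ∈ Set.range g := by
  by_contra hj
  exact h (Function.extend_apply' _ _ _ (by simpa using hj))

theorem not_strictlyAlternates_extend {k m : ℕ} (g : Fin k → Fin m) (s : Fin k → ℝ) :
    ¬ StrictlyAlternates (k + 1) (Function.extend g s 0) := by
  classical
  rintro ⟨f, hf, ε, hε, h⟩
  have hsub : Finset.univ.image f ⊆ Finset.univ.image g := by
    intro x hx
    obtain ⟨j, -, rfl⟩ := Finset.mem_image.1 hx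
    have := mem_range_of_extend_ne_zero (right_ne_zero_of_mul (h j).ne')
    simpa using this
  have h1 := Finset.card_le_card hsub
  have h2 := Finset.card_image_le (s := Finset.univ) (f := g)
  rw [Finset.card_image_of_injective _ hf.injective] at h1
  simp at h1 h2
  omega

theorem extend_ne_zero {k m : ℕ} {g : Fin k → Fin m} (hg : Function.Injective g) {s : Fin k → ℝ}
    (hs : s ≠ 0) : Function.extend g s 0 ≠ 0 := by
  intro h
  refine hs (funext fun c => ?_)
  have := congrFun h (g c)
  rwa [hg.extend_apply] at this

section

variable {n m k : ℕ} {X : Matrix (Fin n) (Fin m) ℝ}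

theorem det_submatrix_ne_zero (hkn : k < n)
    (H : ∀ u, u ≠ 0 → WeaklyAlternates (k + 1) (X *ᵥ u) → StrictlyAlternates (k + 1) u)
    {f : Fin k → Fin n} {g : Fin k → Fin m} (hf : StrictMono f) (hg : StrictMono g) :
    (X.submatrix f g).det ≠ 0 := by
  intro h
  obtain ⟨s, hs, hs0⟩ := Matrix.exists_mulVec_eq_zero_iff.2 h
  refine not_strictlyAlternates_extend g s (H _ (extend_ne_zero hg.injective hs) ?_)
  refine weaklyAlternates_of_comp_eq_zero hkn hf fun j => ?_
  rw [mulVec_extend_apply X hg.injective]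
  exact congrFun hs0 j

theorem det_submatrix_mul_pos_of_exchange_row (hkn : k < n)
    (H : ∀ u, u ≠ 0 → WeaklyAlternates (k + 1) (X *ᵥ u) → StrictlyAlternates (k + 1) u)
    {f : Fin (k + 1) → Fin n} {g : Fin k → Fin m} (hf : StrictMono f) (hg : StrictMono g)
    (i j : Fin (k + 1)) :
    0 < (X.submatrix (f ∘ i.succAbove) g).det * (X.submatrix (f ∘ j.succAbove) g).det := by
  have hD : ∀ l : Fin (k + 1), (X.submatrix (f ∘ l.succAbove) g).det ≠ 0 := fun l =>
    det_submatrix_ne_zero hkn H (hf.comp (Fin.strictMono_succAbove l)) hg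
  rcases eq_or_ne j i with rfl | hij
  · exact mul_self_pos.2 (hD j)
  by_contra! hneg
  obtain ⟨j', hj'⟩ := Fin.exists_succAbove_eq hij
  set B := X.submatrix (f ∘ i.succAbove) g with hB
  set s : Fin k → ℝ := B⁻¹ *ᵥ Pi.single j' 1 with hs
  have hBs : B *ᵥ s = Pi.single j' 1 := by
    rw [hs, Matrix.mulVec_mulVec, Matrix.mul_nonsing_inv _ (hD i).isUnit, Matrix.one_mulVec]
  have hs0 : s ≠ 0 := by
    intro h
    rw [h, Matrix.mulVec_zero] at hBs
    have := congrFun hBs j'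
    simp at this
  set M := X.submatrix f g with hM
  have hMj : (M *ᵥ s) j = 1 := by
    rw [← hj']
    change (B *ᵥ s) j' = 1
    simp [hBs]
  have hMl : ∀ l, l ≠ i → l ≠ j → (M *ᵥ s) l = 0 := by
    intro l hli hlj
    obtain ⟨l', rfl⟩ := Fin.exists_succAbove_eq hli
    change (B *ᵥ s) l' = 0
    rw [hBs, Pi.single_eq_of_ne]
    rintro rfl
    exact hlj hj'
  have hsum := sum_alternating_mulVec_mul_det M s
  rw [Fintype.sum_eq_add i j hij.symm (fun l hl => by rw [hMl l hl.1 hl.2]; ring), hMj] at hsum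
  refine not_strictlyAlternates_extend g s (H _ (extend_ne_zero hg.injective hs0) ?_)
  refine ⟨f, hf, (-1) ^ (j : ℕ), by simp, fun l => ?_⟩
  rw [mulVec_extend_apply X hg.injective]
  change 0 ≤ (-1) ^ (j : ℕ) * (-1) ^ (l : ℕ) * (M *ᵥ s) l
  rcases eq_or_ne l j with rfl | hlj
  · simp [hMj, ← mul_pow]
  rcases eq_or_ne l i with rfl | hli
  · change (-1) ^ (l : ℕ) * (M *ᵥ s) l * B.det +
      (-1) ^ (j : ℕ) * 1 * (X.submatrix (f ∘ j.succAbove) g).det = 0 at hsum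
    set C := (X.submatrix (f ∘ j.succAbove) g).det
    have hjj : ((-1 : ℝ) ^ (j : ℕ)) * (-1) ^ (j : ℕ) = 1 := by simp [← mul_pow]
    have e1 : ((-1) ^ (j : ℕ) * (-1) ^ (l : ℕ) * (M *ᵥ s) l) * B.det ^ 2 = -(B.det * C) := by
      linear_combination (-1) ^ (j : ℕ) * B.det * hsum - B.det * C * hjj
    have e2 : 0 < B.det ^ 2 := by have := hD l; positivity
    exact nonneg_of_mul_nonneg_left (by rw [e1]; linarith) e2
  · simp [hMl l hli hlj]

theorem det_submatrix_mul_pos_of_exchange_column (hkn : k < n)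
    (H : ∀ u, u ≠ 0 → WeaklyAlternates (k + 1) (X *ᵥ u) → StrictlyAlternates (k + 1) u)
    {f : Fin k → Fin n} {g : Fin (k + 1) → Fin m} (hf : StrictMono f) (hg : StrictMono g)
    (i j : Fin (k + 1)) :
    0 < (X.submatrix f (g ∘ i.succAbove)).det * (X.submatrix f (g ∘ j.succAbove)).det := by
  have hD : ∀ l : Fin (k + 1), (X.submatrix f (g ∘ l.succAbove)).det ≠ 0 := fun l =>
    det_submatrix_ne_zero hkn H hf (hg.comp (Fin.strictMono_succAbove l))
  set s : Fin (k + 1) → ℝ := fun l => (-1) ^ (l : ℕ) * (X.submatrix f (g ∘ l.succAbove)).det with hs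
  have hs0 : s ≠ 0 := by
    intro h
    have := congrFun h 0
    simp only [hs, Fin.val_zero, pow_zero, one_mul, Pi.zero_apply] at this
    exact hD 0 this
  obtain ⟨f', hf', ε, hε, h⟩ := H _ (extend_ne_zero hg.injective hs0) <| by
    refine weaklyAlternates_of_comp_eq_zero hkn hf fun j => ?_
    rw [mulVec_extend_apply X hg.injective]
    exact congrFun (mulVec_alternating_det_eq_zero (X.submatrix f g)) j
  have hfg : f' = g := by
    classical
    have hsub : Finset.univ.image f' ⊆ Finset.univ.image g := by
      intro x hx
      obtain ⟨j, -, rfl⟩ := Finset.mem_image.1 hx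
      have := mem_range_of_extend_ne_zero (right_ne_zero_of_mul (h j).ne')
      simpa using this
    have he := Finset.eq_of_subset_of_card_le hsub (by
      rw [Finset.card_image_of_injective _ hf'.injective,
        Finset.card_image_of_injective _ hg.injective])
    refine (StrictMono.range_inj hf' hg).1 ?_
    simpa using congrArg (fun s : Finset (Fin m) => (s : Set (Fin m))) he
  subst hfg
  have hpos : ∀ l : Fin (k + 1), 0 < ε * (X.submatrix f (f' ∘ l.succAbove)).det := by
    intro l
    have h1 := h l
    rw [hf'.injective.extend_apply] at h1
    have h2 : ((-1 : ℝ) ^ (l : ℕ)) * (-1) ^ (l : ℕ) = 1 := by simp [← mul_pow]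
    have h3 : ε * (-1) ^ (l : ℕ) * s l = ε * (X.submatrix f (f' ∘ l.succAbove)).det := by
      simp only [hs]
      linear_combination ε * (X.submatrix f (f' ∘ l.succAbove)).det * h2
    rwa [h3] at h1
  have h1 := mul_pos (hpos i) (hpos j)
  rw [mul_mul_mul_comm] at h1
  exact pos_of_mul_pos_right h1 (mul_self_nonneg _)

theorem ssc_of_weaklyAlternates_imp (hkn : k < n)
    (H : ∀ u, u ≠ 0 → WeaklyAlternates (k + 1) (X *ᵥ u) → StrictlyAlternates (k + 1) u) :
    SSC X k := by
  have hD : ∀ (f : Fin k → Fin n) (g : Fin k → Fin m), StrictMono f → StrictMono g →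
      (X.submatrix f g).det ≠ 0 := fun f g hf hg => det_submatrix_ne_zero hkn H hf hg
  have hall : ∀ (f f' : Fin k → Fin n) (g g' : Fin k → Fin m), StrictMono f → StrictMono f' →
      StrictMono g → StrictMono g' → 0 < (X.submatrix f g).det * (X.submatrix f' g').det := by
    intro f f' g g' hf hf' hg hg'
    have h1 := mul_pos_of_forall_exchange (fun f => (X.submatrix f g).det)
      (fun f hf => hD f g hf hg)
      (fun F hF => det_submatrix_mul_pos_of_exchange_row hkn H hF hg) hf hf'
    have h2 := mul_pos_of_forall_exchange (fun g => (X.submatrix f' g).det)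
      (fun g hg => hD f' g hf' hg)
      (fun G hG => det_submatrix_mul_pos_of_exchange_column hkn H hf' hG) hg hg'
    have h3 := mul_pos h1 h2
    have h4 : (X.submatrix f g).det * (X.submatrix f' g).det *
        ((X.submatrix f' g).det * (X.submatrix f' g').det) =
        (X.submatrix f' g).det ^ 2 * ((X.submatrix f g).det * (X.submatrix f' g').det) := by ring
    rw [h4] at h3
    exact pos_of_mul_pos_right h3 (sq_nonneg _)
  by_cases hp : ∀ (f : Fin k → Fin n) (g : Fin k → Fin m), StrictMono f → StrictMono g →
      0 < (X.submatrix f g).det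
  · exact Or.inl hp
  · push Not at hp
    obtain ⟨f₀, g₀, hf₀, hg₀, h₀⟩ := hp
    exact Or.inr fun f g hf hg => neg_of_mul_pos_right (hall f₀ f g₀ g hf₀ hf hg₀ hg) h₀

end

theorem exists_isChain_sublist (t : List ℝ) (a : ℝ) (h0 : ∀ x ∈ a :: t, x ≠ 0) :
    ∃ (h : ℝ) (t' : List ℝ), (h :: t').Sublist (a :: t) ∧ t'.length = signChanges (a :: t) ∧
      0 < a * h ∧ (h :: t').IsChain (fun x y => x * y < 0) := by
  induction t generalizing a with
  | nil =>
    exact ⟨a, [], List.Sublist.refl _, by simp [signChanges], mul_self_pos.2 (h0 a (by simp)),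
      by simp⟩
  | cons b s ih =>
    obtain ⟨h, t', hsub, hlen, hpos, hch⟩ := ih b fun x hx => h0 x (List.mem_cons_of_mem _ hx)
    have ha : a ≠ 0 := h0 a (by simp)
    have hb : b ≠ 0 := h0 b (by simp)
    have key : (a * b) * (b * h) = b ^ 2 * (a * h) := by ring
    have hb2 : 0 < b ^ 2 := by positivity
    rw [signChanges_cons_cons]
    by_cases hab : a * b < 0
    · refine ⟨a, h :: t', hsub.cons_cons a, by simp [hlen, hab], mul_self_pos.2 ha, ?_⟩
      rw [List.isChain_cons_cons]
      refine ⟨?_, hch⟩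
      have := mul_neg_of_neg_of_pos hab hpos
      rw [key] at this
      exact (pos_iff_neg_of_mul_neg this).1 hb2
    · refine ⟨h, t', hsub.cons a, by simp [hlen, hab], ?_, hch⟩
      have hab' : 0 < a * b := lt_of_le_of_ne (not_lt.1 hab) (mul_ne_zero ha hb).symm
      have := mul_pos hab' hpos
      rw [key] at this
      exact pos_of_mul_pos_right this hb2.le

theorem length_le_signChanges_of_isChain (t : List ℝ) (a : ℝ) (h0 : ∀ x ∈ a :: t, x ≠ 0)
    (h : ℝ) (t' : List ℝ) (hsub : (h :: t').Sublist (a :: t))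
    (hch : (h :: t').IsChain (fun x y => x * y < 0)) :
    t'.length + (if a * h < 0 then 1 else 0) ≤ signChanges (a :: t) := by
  induction t generalizing a h t' with
  | nil =>
    have h1 := hsub.length_le
    simp only [List.length_cons, List.length_nil] at h1
    obtain rfl : t' = [] := List.eq_nil_of_length_eq_zero (by omega)
    obtain rfl : h = a := by simpa using hsub
    simp [signChanges, not_lt.2 (mul_self_nonneg h)]
  | cons b s ih =>
    have ih' := ih b fun x hx => h0 x (List.mem_cons_of_mem _ hx)
    have hb : b ≠ 0 := h0 b (by simp)
    have hb2 : 0 < b ^ 2 := by positivity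
    have key : ∀ c, a * c < 0 → ¬ b * c < 0 → a * b < 0 := by
      intro c h1 h2
      by_contra h3
      have : (a * b) * (b * c) = b ^ 2 * (a * c) := by ring
      nlinarith [mul_nonneg (not_lt.1 h3) (not_lt.1 h2)]
    rw [signChanges_cons_cons]
    rcases List.cons_sublist_cons'.1 hsub with h1 | ⟨rfl, h1⟩
    · have h2 := ih' h t' h1 hch
      have h3 := key h
      split_ifs at * <;> first | omega | tauto
    · rw [if_neg (not_lt.2 (mul_self_nonneg h))]
      rcases t' with _ | ⟨c, t''⟩
      · simp
      · rw [List.isChain_cons_cons] at hch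
        have h2 := ih' c t'' h1 hch.2
        have h3 := key c hch.1
        simp only [List.length_cons]
        split_ifs at * <;> first | omega | tauto

theorem lt_signChanges_iff (K : ℕ) (l : List ℝ) (h0 : ∀ x ∈ l, x ≠ 0) :
    K < signChanges l ↔ ∃ l' : List ℝ, l'.Sublist l ∧ l'.length = K + 2 ∧
      l'.IsChain (fun x y => x * y < 0) := by
  rcases l with _ | ⟨a, t⟩
  · simp [signChanges]
  constructor
  · intro hK
    obtain ⟨h, t', hsub, hlen, -, hch⟩ := exists_isChain_sublist t a h0
    refine ⟨(h :: t').take (K + 2), (List.take_sublist _ _).trans hsub, ?_, hch.take _⟩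
    simp only [List.length_take, List.length_cons]
    omega
  · rintro ⟨_ | ⟨h, t'⟩, hsub, hlen, hch⟩
    · simp at hlen
    · have := length_le_signChanges_of_isChain t a h0 h t' hsub hch
      simp only [List.length_cons] at hlen
      omega

theorem exists_isChain_sublist_ofFn_iff {m : ℕ} (K : ℕ) (u : Fin m → ℝ) :
    (∃ l' : List ℝ, l'.Sublist (List.ofFn u) ∧ l'.length = K + 2 ∧
      l'.IsChain (fun x y => x * y < 0)) ↔ StrictlyAlternates (K + 2) u := by
  constructor
  · rintro ⟨l', hsub, hlen, hch⟩
    obtain ⟨e, he⟩ := List.sublist_iff_exists_fin_orderEmbedding_get_eq.1 hsub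
    rw [List.isChain_iff_getElem] at hch
    let f : Fin (K + 2) → Fin m := fun j =>
      Fin.cast (List.length_ofFn) (e (Fin.cast hlen.symm j))
    have hf : StrictMono f := fun i j hij => by
      have : e (Fin.cast hlen.symm i) < e (Fin.cast hlen.symm j) := e.strictMono hij
      exact this
    have huf : ∀ (i : ℕ) (hi : i < K + 2), u (f ⟨i, hi⟩) = l'[i] := by
      intro i hi
      have := he ⟨i, by omega⟩
      simp only [List.get_eq_getElem, List.getElem_ofFn] at this
      rw [this]
      rfl
    have hstep : ∀ (i : ℕ) (hi : i + 1 < K + 2),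
        u (f ⟨i, by omega⟩) * u (f ⟨i + 1, hi⟩) < 0 := by
      intro i hi
      rw [huf, huf]
      exact hch i (by omega)
    have h00 : u (f 0) ≠ 0 := by
      intro h
      have := hstep 0 (by omega)
      rw [show (⟨0, by omega⟩ : Fin (K + 2)) = 0 from rfl, h] at this
      simp at this
    refine ⟨f, hf, u (f 0), h00, ?_⟩
    rintro ⟨i, hi⟩
    simp only
    induction i with
    | zero => simpa using mul_self_pos.2 h00
    | succ i ih =>
      have h1 := ih (by omega)
      have h2 := hstep i hi
      simp only [pow_succ] at h1 ⊢
      set c := u (f 0) * (-1) ^ i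
      set x := u (f ⟨i, by omega⟩)
      set y := u (f ⟨i + 1, hi⟩)
      have h3 : (c * x) * (c * y) < 0 := by
        have : (c * x) * (c * y) = c ^ 2 * (x * y) := by ring
        rw [this]
        have : c ≠ 0 := left_ne_zero_of_mul h1.ne'
        exact mul_neg_of_pos_of_neg (by positivity) h2
      have h4 := (pos_iff_neg_of_mul_neg h3).1 h1
      rw [← mul_assoc, mul_neg_one, neg_mul]
      linarith
  · rintro ⟨f, hf, ε, hε, h⟩
    refine ⟨List.ofFn (u ∘ f), ?_, by simp, ?_⟩
    · rw [List.sublist_iff_exists_fin_orderEmbedding_get_eq]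
      refine ⟨OrderEmbedding.ofStrictMono
        (fun i => Fin.cast (List.length_ofFn).symm (f (Fin.cast List.length_ofFn i))) ?_, ?_⟩
      · intro i j hij
        exact hf (show Fin.cast List.length_ofFn i < Fin.cast List.length_ofFn j from hij)
      · intro i
        simp only [List.get_eq_getElem, List.getElem_ofFn]
        rfl
    · rw [List.isChain_iff_getElem]
      intro i hi
      simp only [List.length_ofFn] at hi
      simp only [List.getElem_ofFn, Function.comp]
      have h1 := h ⟨i, by omega⟩
      have h2 := h ⟨i + 1, hi⟩
      simp only [pow_succ] at h1 h2
      set x := u (f ⟨i, by omega⟩)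
      set y := u (f ⟨i + 1, hi⟩)
      have h3 := mul_pos h1 h2
      have h4 : ε * (-1) ^ i * x * (ε * ((-1) ^ i * -1) * y) =
          -((ε * (-1) ^ i) ^ 2 * (x * y)) := by ring
      rw [h4] at h3
      by_contra! hc
      nlinarith [mul_nonneg (sq_nonneg (ε * (-1) ^ i)) hc]

theorem variation_le_iff {m : ℕ} (K : ℕ) (u : Fin m → ℝ) :
    variation u ≤ (K : ℤ) ↔ ¬ StrictlyAlternates (K + 2) u := by
  have hnz : ∀ x ∈ (List.ofFn u).filter fun x => decide (x ≠ 0), x ≠ 0 := by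
    intro x hx
    simpa using (List.mem_filter.1 hx).2
  have hv : variation u ≤ (K : ℤ) ↔
      ¬ K < signChanges ((List.ofFn u).filter fun x => decide (x ≠ 0)) := by
    unfold variation
    split_ifs with h
    · rw [h]
      simp only [signChanges, List.zip_nil_left, List.countP_nil]
      omega
    · omega
  rw [hv, lt_signChanges_iff K _ hnz, ← exists_isChain_sublist_ofFn_iff, not_iff_not]
  constructor
  · rintro ⟨l', hsub, h⟩
    exact ⟨l', hsub.trans List.filter_sublist, h⟩
  · rintro ⟨l', hsub, hlen, hch⟩
    refine ⟨l', ?_, hlen, hch⟩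
    have hl' : l'.filter (fun x => decide (x ≠ 0)) = l' := by
      rw [List.filter_eq_self]
      intro x hx
      simp only [decide_eq_true_eq]
      rintro rfl
      obtain ⟨i, hi, hx⟩ := List.mem_iff_getElem.1 hx
      rw [List.isChain_iff_getElem] at hch
      rcases i with _ | i
      · have := hch 0 (by omega)
        simp [hx] at this
      · have := hch i (by omega)
        simp [hx] at this
    rw [← hl']
    exact hsub.filter _

theorem maxVariation_le_iff_s1 {n : ℕ} (K : ℕ) (y : Fin n → ℝ) :
    maxVariation y ≤ (K : ℤ) ↔ ¬ WeaklyAlternates (K + 2) y := by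
  set S := {v : ℤ | ∃ w : Fin n → ℝ, (∀ i, w i ≠ 0) ∧ (∀ i, y i ≠ 0 → w i = y i) ∧
    v = (signChanges (List.ofFn w) : ℤ)} with hS
  have hne : S.Nonempty := by
    refine ⟨_, fun i => if y i = 0 then 1 else y i, fun i => ?_, fun i hi => ?_, rfl⟩
    · simp only
      split_ifs with h
      · exact one_ne_zero
      · exact h
    · simp [hi]
  have hbdd : BddAbove S := by
    refine ⟨n, ?_⟩
    rintro v ⟨w, -, -, rfl⟩
    have h1 := List.countP_le_length (p := fun p : ℝ × ℝ => decide (p.1 * p.2 < 0))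
      (l := (List.ofFn w).zip (List.ofFn w).tail)
    rw [List.length_zip, List.length_ofFn] at h1
    exact_mod_cast h1.trans (min_le_left _ _)
  have hlt : ∀ w : Fin n → ℝ, (∀ i, w i ≠ 0) →
      (K < signChanges (List.ofFn w) ↔ StrictlyAlternates (K + 2) w) := fun w hw => by
    rw [lt_signChanges_iff K _ (by simpa [List.mem_ofFn] using hw),
      exists_isChain_sublist_ofFn_iff]
  rw [← not_lt, not_iff_not]
  constructor
  · intro h
    obtain ⟨w, hw, hwy, hv⟩ := Int.csSup_mem hne hbdd
    have h1 : K < signChanges (List.ofFn w) := by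
      have : (K : ℤ) < signChanges (List.ofFn w) := hv ▸ h
      exact_mod_cast this
    obtain ⟨f, hf, ε, hε, h2⟩ := (hlt w hw).1 h1
    refine ⟨f, hf, ε, hε, fun j => ?_⟩
    by_cases hj : y (f j) = 0
    · simp [hj]
    · rw [← hwy _ hj]
      exact (h2 j).le
  · rintro ⟨f, hf, ε, hε, h⟩
    classical
    let w : Fin n → ℝ := fun i => if y i ≠ 0 then y i else
      Function.extend f (fun j => ε * (-1) ^ (j : ℕ)) (fun _ => 1) i
    have hw : ∀ i, w i ≠ 0 := by
      intro i
      by_cases hi : y i = 0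
      · simp only [w, hi, ne_eq, not_true_eq_false, if_false]
        by_cases hr : ∃ j, f j = i
        · obtain ⟨j, rfl⟩ := hr
          rw [hf.injective.extend_apply]
          simp [hε]
        · rw [Function.extend_apply' _ _ _ hr]
          exact one_ne_zero
      · simp [w, hi]
    have hwy : ∀ i, y i ≠ 0 → w i = y i := fun i hi => by simp [w, hi]
    have hK : K < signChanges (List.ofFn w) := by
      refine (hlt w hw).2 ⟨f, hf, ε, hε, fun j => ?_⟩
      by_cases hj : y (f j) = 0
      · simp only [w, hj, ne_eq, not_true_eq_false, if_false, hf.injective.extend_apply]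
        exact mul_self_pos.2 (by simp [hε])
      · rw [hwy _ hj]
        exact lt_of_le_of_ne (h j) (by simp [hε, hj])
    have hmem : (signChanges (List.ofFn w) : ℤ) ∈ S := ⟨w, hw, hwy, rfl⟩
    have h1 := le_csSup hbdd hmem
    have h2 : (K : ℤ) < signChanges (List.ofFn w) := by exact_mod_cast hK
    exact h2.trans_le h1

theorem svb_iff {n m : ℕ} (X : Matrix (Fin n) (Fin m) ℝ) (K : ℕ) :
    SVB X K ↔ ∀ u, u ≠ 0 → WeaklyAlternates (K + 2) (X *ᵥ u) → StrictlyAlternates (K + 2) u := by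
  simp only [SVB, variation_le_iff, maxVariation_le_iff_s1, not_imp_not]

/-- for `1 ≤ k ≤ m`, `k ≤ n - 1`, `X` is strictly `k`-sign consistent iff
`X` is strictly `(k-1)`-variation bounding. -/
theorem stmt1 {n m : ℕ} (X : Matrix (Fin n) (Fin m) ℝ) (k : ℕ)
    (hk : 1 ≤ k) (hkm : k ≤ m) (hkn : k ≤ n - 1) :
    SSC X k ↔ SVB X (k - 1) := by
  obtain ⟨K, rfl⟩ : ∃ K, k = K + 1 := ⟨k - 1, by omega⟩
  rw [Nat.add_sub_cancel, svb_iff]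
  constructor
  · intro h u hu hw
    by_contra hs
    rcases h with h | h
    · exact not_weaklyAlternates_mulVec (σ := 1) hk hkm
        (fun f g hf hg => by simpa using h f g hf hg) hu hs hw
    · exact not_weaklyAlternates_mulVec (σ := -1) hk hkm
        (fun f g hf hg => by simpa using h f g hf hg) hu hs hw
  · exact ssc_of_weaklyAlternates_imp (by omega)
end
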